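/- Let 𝔾 be a toroidal grid diagram representing a knot, with 4-fold diagram 𝔾₄. For any pair of indices i, j ∈ {1,…,n}, multiplication by V_i is chain homotopic to multiplication by V_j when viewed as homogeneous endomorphisms of the chain complex (GC•(𝔾₄), ∂₄•) of degree (−2,−1). -/

import Mathlib

/-!
Combinatorial model of toroidal grid diagrams, their 4-fold covers, and the
double-point enhanced grid complex (over 𝔽 = ℤ/2ℤ), following Lipshitz and
Ozsváth–Szabó–Sarkar conventions.

* The torus is modelled by `ZMod n × ZMod n`: the horizontal circle `α_j` and
  vertical circle `β_k` meet at the point `(k, j)`; the square `(k, j)` is the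
  one with south-west corner at the point `(k, j)`;  the `O`- and `X`-markings
  of column `k` occupy squares `(k, Orow k)` and `(k, Xrow k)`.
* A grid state is a bijection (column ↦ row), i.e. a permutation of `ZMod n`.
* The 4-fold cover `𝔾₄` lives on `ZMod (2n) × ZMod (2n)`, with the covering
  map `pr` reducing coordinates mod `n`.  A grid state of `𝔾₄` is the preimage
  of a grid state of `𝔾`, so grid states of `𝔾₄` are canonically identified
  with grid states of `𝔾`; similarly the free module `GC` underlying both
  `GC•(𝔾)` and `GC•(𝔾₄)` is the same, and the identification `J₄` is the
  identity map.
* Rectangles are recorded by their two vertical circles (west/east) and two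
  horizontal circles (south/north); "rectangle from x₄ to y₄" is the boundary
  condition `∂(∂_α(r + Nr + Er + NEr)) = y₄ - x₄` (and the `∂_β` analogue),
  expressed via corner-point indicator functions.  Each `N,E`-equivalence class
  of rectangles in `𝔾₄` contains exactly one *normalized* representative
  (west circle and south circle in the first fundamental domain), so sums over
  equivalence classes are sums over normalized representatives.
-/

noncomputable section

open scoped Classical

namespace GridHomology

/-- the ground field `𝔽 = ℤ/2ℤ` -/
abbrev F : Type := ZMod 2

/-- A toroidal grid diagram of grid number `n`. -/
structure GridDiagram (n : ℕ) where
  Orow : ZMod n → ZMod n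
  Xrow : ZMod n → ZMod n
  hO : Function.Bijective Orow
  hX : Function.Bijective Xrow
  hOX : ∀ i, Orow i ≠ Xrow i

/-- A grid state: one point on each horizontal and each vertical circle. -/
abbrev GridState (n : ℕ) := Equiv.Perm (ZMod n)

instance twoMulNeZero (n : ℕ) [NeZero n] : NeZero (2 * n) :=
  ⟨fun h => NeZero.ne n (by omega)⟩

/-- membership in the cyclic (going east/north) interval `[u, v)` -/
def inIco {m : ℕ} (u v k : ZMod m) : Prop := (k - u).val < (v - u).val

/-- membership in the open cyclic interval `(u, v)` -/
def inIoo {m : ℕ} (u v k : ZMod m) : Prop :=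
  0 < (k - u).val ∧ (k - u).val < (v - u).val

instance {m : ℕ} (u v k : ZMod m) : Decidable (inIco u v k) :=
  inferInstanceAs (Decidable (_ < _))

instance {m : ℕ} (u v k : ZMod m) : Decidable (inIoo u v k) :=
  inferInstanceAs (Decidable (_ ∧ _))

/-- Rectangle data on the `m × m` torus: west and east vertical circles,
south and north horizontal circles. -/
structure Rect (m : ℕ) where
  cW : ZMod m
  cE : ZMod m
  rS : ZMod m
  rN : ZMod m
deriving DecidableEq

instance (m : ℕ) [NeZero m] : Fintype (Rect m) :=
  Fintype.ofEquiv (ZMod m × ZMod m × ZMod m × ZMod m)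
    { toFun := fun p => ⟨p.1, p.2.1, p.2.2.1, p.2.2.2⟩
      invFun := fun r => ⟨r.cW, r.cE, r.rS, r.rN⟩
      left_inv := fun _ => rfl
      right_inv := fun _ => rfl }

/-- local multiplicity of a rectangle at a square of the torus -/
def Rect.mult {m : ℕ} (r : Rect m) (sq : ZMod m × ZMod m) : ℕ :=
  if inIco r.cW r.cE sq.1 ∧ inIco r.rS r.rN sq.2 then 1 else 0

/-- `r` is an (embedded, not necessarily empty) rectangle from `x` to `y` in `𝔾`:
its south-west and north-east corners lie in `x`, its south-east and north-west
corners lie in `y`, and `x`, `y` agree away from the two vertical circles of `r`. -/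
def IsRectFrom {m : ℕ} (x y : GridState m) (r : Rect m) : Prop :=
  r.cW ≠ r.cE ∧ r.rS ≠ r.rN ∧
  x r.cW = r.rS ∧ x r.cE = r.rN ∧ y r.cW = r.rN ∧ y r.cE = r.rS ∧
  ∀ k, k ≠ r.cW → k ≠ r.cE → x k = y k

/-- point-measure of a rectangle in `𝔾` at a grid state `w`: the sum over the
points of `w` of the average of the four adjacent local multiplicities -/
def Rect.pm {m : ℕ} [NeZero m] (w : GridState m) (r : Rect m) : ℚ :=
  (∑ k : ZMod m, ((r.mult (k - 1, w k - 1) + r.mult (k, w k - 1) +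
      r.mult (k - 1, w k) + r.mult (k, w k) : ℕ) : ℚ)) / 4

/-- `m(r) = #(Int r ∩ x)` -/
def Rect.intCount {m : ℕ} [NeZero m] (x : GridState m) (r : Rect m) : ℕ :=
  (Finset.univ.filter fun k => inIoo r.cW r.cE k ∧ inIoo r.rS r.rN (x k)).card

/-- `O_i(r)` in `𝔾` -/
def Ocount {m : ℕ} (G : GridDiagram m) (r : Rect m) (i : ZMod m) : ℕ :=
  r.mult (i, G.Orow i)

/-- `X_i(r)` in `𝔾` -/
def Xcount {m : ℕ} (G : GridDiagram m) (r : Rect m) (i : ZMod m) : ℕ :=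
  r.mult (i, G.Xrow i)

/-- `r ∩ 𝕏 = ∅` -/
def XDisjoint {m : ℕ} (G : GridDiagram m) (r : Rect m) : Prop :=
  ∀ i, Xcount G r i = 0

/-! ### The 4-fold cover -/

/-- the covering projection `π₄ : 𝔾₄ → 𝔾` on coordinates -/
def pr {n : ℕ} (a : ZMod (2 * n)) : ZMod n :=
  ZMod.castHom (dvd_mul_left n 2) (ZMod n) a

/-- indicator function (as a formal sum of points) of the lifted grid state `x₄` -/
def stInd {n : ℕ} (x : GridState n) (p : ZMod (2 * n) × ZMod (2 * n)) : ℤ :=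
  if x (pr p.1) = pr p.2 then 1 else 0

/-- `∂(∂_α r)` as a formal sum of points: `SE + NW − SW − NE` -/
def cornerA {m : ℕ} (r : Rect m) (p : ZMod m × ZMod m) : ℤ :=
  (if p = (r.cE, r.rS) then 1 else 0) + (if p = (r.cW, r.rN) then 1 else 0)
    - (if p = (r.cW, r.rS) then 1 else 0) - (if p = (r.cE, r.rN) then 1 else 0)

/-- `∂(∂_β r)` as a formal sum of points: `NE + SW − SE − NW` -/
def cornerB {m : ℕ} (r : Rect m) (p : ZMod m × ZMod m) : ℤ :=
  (if p = (r.cE, r.rN) then 1 else 0) + (if p = (r.cW, r.rS) then 1 else 0)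
    - (if p = (r.cE, r.rS) then 1 else 0) - (if p = (r.cW, r.rN) then 1 else 0)

/-- northward translation `N` by `n` rows -/
def trN {n : ℕ} (r : Rect (2 * n)) : Rect (2 * n) :=
  ⟨r.cW, r.cE, r.rS + (n : ZMod (2 * n)), r.rN + (n : ZMod (2 * n))⟩

/-- eastward translation `E` by `n` columns -/
def trE {n : ℕ} (r : Rect (2 * n)) : Rect (2 * n) :=
  ⟨r.cW + (n : ZMod (2 * n)), r.cE + (n : ZMod (2 * n)), r.rS, r.rN⟩

/-- `r` is a rectangle from `x₄` to `y₄` in the 4-fold diagram `𝔾₄`: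
`∂(∂_α (r + Nr + Er + NEr)) = y₄ − x₄` and `∂(∂_β (r + Nr + Er + NEr)) = x₄ − y₄`. -/
def IsRect4From {n : ℕ} (x y : GridState n) (r : Rect (2 * n)) : Prop :=
  r.cW ≠ r.cE ∧ r.rS ≠ r.rN ∧
  (∀ p, cornerA r p + cornerA (trN r) p + cornerA (trE r) p + cornerA (trN (trE r)) p
      = stInd y p - stInd x p) ∧
  (∀ p, cornerB r p + cornerB (trN r) p + cornerB (trE r) p + cornerB (trN (trE r)) p
      = stInd x p - stInd y p)

/-- the canonical (normalized) representative of each `{r, Nr, Er, NEr}`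
equivalence class: west and south coordinates lie in the first fundamental domain -/
def normal4 {n : ℕ} (r : Rect (2 * n)) : Prop := r.cW.val < n ∧ r.rS.val < n

instance {n : ℕ} (r : Rect (2 * n)) : Decidable (normal4 r) :=
  inferInstanceAs (Decidable (_ ∧ _))

/-- `O_i[r₄]`: total multiplicity of `r₄` at the four lifts of `O_i` -/
def O4count {n : ℕ} [NeZero n] (G : GridDiagram n) (r : Rect (2 * n)) (i : ZMod n) : ℕ :=
  ∑ p : ZMod (2 * n) × ZMod (2 * n),
    if pr p.1 = i ∧ pr p.2 = G.Orow i then r.mult p else 0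

/-- `X_i[r₄]` -/
def X4count {n : ℕ} [NeZero n] (G : GridDiagram n) (r : Rect (2 * n)) (i : ZMod n) : ℕ :=
  ∑ p : ZMod (2 * n) × ZMod (2 * n),
    if pr p.1 = i ∧ pr p.2 = G.Xrow i then r.mult p else 0

/-- `r₄ ∩ π₄⁻¹(𝕏) = ∅` -/
def XDisjoint4 {n : ℕ} [NeZero n] (G : GridDiagram n) (r : Rect (2 * n)) : Prop :=
  ∀ i, X4count G r i = 0

/-- point-measure of a domain (an integer-valued multiplicity function on the
squares of `𝔾₄`) at the lifted grid state `w₄` -/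
def pm4 {n : ℕ} [NeZero n] (w : GridState n) (ψ : ZMod (2 * n) × ZMod (2 * n) → ℤ) : ℚ :=
  (∑ p : ZMod (2 * n) × ZMod (2 * n),
    if w (pr p.1) = pr p.2 then
      ((ψ (p.1 - 1, p.2 - 1) + ψ (p.1, p.2 - 1) + ψ (p.1 - 1, p.2) + ψ p : ℤ) : ℚ)
    else 0) / 4

/-- a rectangle of `𝔾₄` viewed as a domain -/
def Rect.dom4 {n : ℕ} (r : Rect (2 * n)) : ZMod (2 * n) × ZMod (2 * n) → ℤ :=
  fun p => (r.mult p : ℤ)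

/-- point-measure `p_{w₄}[r₄]` of a rectangle of `𝔾₄` -/
def rpm4 {n : ℕ} [NeZero n] (w : GridState n) (r : Rect (2 * n)) : ℚ :=
  pm4 w r.dom4

/-- `m[r₄] = (p_{x₄}[r₄] + p_{y₄}[r₄] − 1)/2`, as a rational number -/
def mQ4 {n : ℕ} [NeZero n] (x y : GridState n) (r : Rect (2 * n)) : ℚ :=
  (rpm4 x r + rpm4 y r - 1) / 2

/-- `m[r₄]` as a natural number (the exponent of `v`) -/
def m4 {n : ℕ} [NeZero n] (x y : GridState n) (r : Rect (2 * n)) : ℕ :=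
  (⌊mQ4 x y r⌋).toNat

/-! ### Maslov and Alexander gradings (via the planar counting function `J`) -/

/-- the points of a planar fundamental domain associated to `f`, in doubled
coordinates (grid states at even positions, markings at odd positions) -/
def ptsOf {m : ℕ} [NeZero m] (f : ZMod m → ZMod m) (off : ℕ) : Finset (ℕ × ℕ) :=
  Finset.univ.image fun k => (2 * k.val + off, 2 * (f k).val + off)

/-- `I(P,Q)`: pairs `(p,q)` with `q` strictly above and strictly to the right of `p` -/
def Icnt (P Q : Finset (ℕ × ℕ)) : ℕ :=
  ∑ p ∈ P, (Q.filter fun q => p.1 < q.1 ∧ p.2 < q.2).card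

/-- `J(P,Q) = (I(P,Q) + I(Q,P))/2` -/
def Jq (P Q : Finset (ℕ × ℕ)) : ℚ := ((Icnt P Q : ℚ) + (Icnt Q P : ℚ)) / 2

/-- the Maslov-type grading `J(x,x) − 2 J(x,P) + J(P,P) + 1` for markings `P` -/
def MaslovOf {m : ℕ} [NeZero m] (f : ZMod m → ZMod m) (x : GridState m) : ℚ :=
  Jq (ptsOf (⇑x) 0) (ptsOf (⇑x) 0) - 2 * Jq (ptsOf (⇑x) 0) (ptsOf f 1)
    + Jq (ptsOf f 1) (ptsOf f 1) + 1

/-- the Maslov grading `M(x) = M_𝕆(x)` -/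
def MaslovO {m : ℕ} [NeZero m] (G : GridDiagram m) (x : GridState m) : ℚ :=
  MaslovOf G.Orow x

/-- `M_𝕏(x)` -/
def MaslovX {m : ℕ} [NeZero m] (G : GridDiagram m) (x : GridState m) : ℚ :=
  MaslovOf G.Xrow x

/-- the Alexander grading `A(x) = (M_𝕆(x) − M_𝕏(x) − (n−1))/2` -/
def Alex {m : ℕ} [NeZero m] (G : GridDiagram m) (x : GridState m) : ℚ :=
  (MaslovO G x - MaslovX G x - ((m : ℚ) - 1)) / 2

/-! ### The double-point enhanced grid complex -/

/-- the ring `𝔽[V₁, …, V_n, v]`: `V_i = X (some i)`, `v = X none` -/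
abbrev Rng (n : ℕ) : Type := MvPolynomial (Option (ZMod n)) F

/-- the free `𝔽[V₁,…,V_n,v]`-module on the set of grid states; it underlies both
`GC•(𝔾)` and `GC•(𝔾₄)` (their grid states being canonically identified) -/
abbrev GC (n : ℕ) := GridState n →₀ Rng n

/-- the variable `V_i` -/
def Vv {n : ℕ} (i : ZMod n) : Rng n := MvPolynomial.X (some i)

/-- the double-point variable `v` -/
def vV {n : ℕ} : Rng n := MvPolynomial.X none

/-- the `𝔽[V₁,…,V_n,v]`-linear map determined by values on grid states -/
def basisMap {n : ℕ} (f : GridState n → GC n) : GC n →ₗ[Rng n] GC n :=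
  Finsupp.lsum (Rng n) fun x => LinearMap.toSpanSingleton (Rng n) (GC n) (f x)

/-- the weight `V₁^{O₁[r₄]} ⋯ V_n^{O_n[r₄]} v^{m[r₄]}` of a rectangle of `𝔾₄` -/
def wt4 {n : ℕ} [NeZero n] (G : GridDiagram n) (x y : GridState n) (r : Rect (2 * n)) :
    Rng n :=
  (∏ i : ZMod n, Vv i ^ O4count G r i) * vV ^ m4 x y r

/-- the differential `∂₄•` of `GC•(𝔾₄)`: counts `N,E`-equivalence classes of
rectangles (via their normalized representatives) disjoint from `π₄⁻¹(𝕏)` -/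
def diff4 {n : ℕ} [NeZero n] (G : GridDiagram n) : GC n →ₗ[Rng n] GC n :=
  basisMap fun x => ∑ y : GridState n,
    ∑ r ∈ Finset.univ.filter
        (fun r : Rect (2 * n) => IsRect4From x y r ∧ normal4 r ∧ XDisjoint4 G r),
      Finsupp.single y (wt4 G x y r)

/-- the weight of a rectangle of `𝔾` -/
def wtB {n : ℕ} [NeZero n] (G : GridDiagram n) (x : GridState n) (r : Rect n) : Rng n :=
  (∏ i : ZMod n, Vv i ^ Ocount G r i) * vV ^ Rect.intCount x r

/-- the differential `∂•` of the double-point enhanced grid complex `GC•(𝔾)` -/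
def diffB {n : ℕ} [NeZero n] (G : GridDiagram n) : GC n →ₗ[Rng n] GC n :=
  basisMap fun x => ∑ y : GridState n,
    ∑ r ∈ Finset.univ.filter
        (fun r : Rect n => IsRectFrom x y r ∧ XDisjoint G r),
      Finsupp.single y (wtB G x r)

/-- `z` is homogeneous of bidegree `(d, s)` for the (Maslov, Alexander) bigrading
extended by `M(V₁^{k₁}⋯V_n^{k_n} v^m ⋅ x) = M(x) − 2Σkᵢ + 2m`,
`A(V₁^{k₁}⋯V_n^{k_n} v^m ⋅ x) = A(x) − Σkᵢ`. -/
def IsHomog {n : ℕ} [NeZero n] (G : GridDiagram n) (z : GC n) (d s : ℚ) : Prop :=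
  ∀ (y : GridState n) (k : Option (ZMod n) →₀ ℕ), MvPolynomial.coeff k (z y) ≠ 0 →
    (MaslovO G y - 2 * ∑ i : ZMod n, (k (some i) : ℚ) + 2 * (k none : ℚ) = d) ∧
    (Alex G y - ∑ i : ZMod n, (k (some i) : ℚ) = s)

/-- a linear map is homogeneous of degree `(a, b)` -/
def MapHomog {n : ℕ} [NeZero n] (G G' : GridDiagram n) (φ : GC n →ₗ[Rng n] GC n)
    (a b : ℚ) : Prop :=
  ∀ z d s, IsHomog G z d s → IsHomog G' (φ z) (d + a) (s + b)

/-- `𝔾` represents a knot: following the link (column `i` joins its `O` to the `X`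
in the same row, etc.) visits every column -/
def IsKnot {n : ℕ} (G : GridDiagram n) : Prop :=
  ∀ i j : ZMod n, ∃ k : ℕ,
    (((Equiv.ofBijective G.Orow G.hO).trans (Equiv.ofBijective G.Xrow G.hX).symm) ^ k) i = j

/-- the homotopy operator `𝓗_{X_j}•` counting equivalence classes of rectangles in
`𝔾₄` crossing the lifts of `X_j` exactly once and no other `X`-marking -/
def HXmap {n : ℕ} [NeZero n] (G : GridDiagram n) (j : ZMod n) : GC n →ₗ[Rng n] GC n :=
  basisMap fun x => ∑ y : GridState n,
    ∑ r ∈ Finset.univ.filter (fun r : Rect (2 * n) =>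
        IsRect4From x y r ∧ normal4 r ∧ X4count G r j = 1 ∧
        ∀ k, k ≠ j → X4count G r k = 0),
      Finsupp.single y (wt4 G x y r)

/-! ### Commutation moves, pentagons and hexagons

`𝔾` and `𝔾'` differ by commuting the (adjacent) columns `c−1` and `c`; they are
drawn on a common torus, sharing all markings and all circles except that the
vertical circle `β_c` of `𝔾` is replaced in `𝔾'` by a curve `γ_c` which passes
to the west of the marking line within the rows of the cyclic interval
`J = [h₁, h₂)` (which contains the markings of column `c−1`) and to the east of
it in the complementary rows (which contain the markings of column `c`);
`γ_c` crosses `β_c` at two points `a` (just south of the row-circle `h₂`) and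
`b` (just south of `h₁`).  Grid states of `𝔾'` are again recorded as
permutations (the `γ`-point in row `j` replacing the `β_c`-point). -/

structure CommData (n : ℕ) where
  G : GridDiagram n
  G' : GridDiagram n
  c : ZMod n
  h₁ : ZMod n
  h₂ : ZMod n
  hne : h₁ ≠ h₂
  hOA : inIco h₁ h₂ (G.Orow (c - 1))
  hXA : inIco h₁ h₂ (G.Xrow (c - 1))
  hOB : ¬ inIco h₁ h₂ (G.Orow c)
  hXB : ¬ inIco h₁ h₂ (G.Xrow c)
  hO'A : G'.Orow (c - 1) = G.Orow c
  hO'B : G'.Orow c = G.Orow (c - 1)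
  hX'A : G'.Xrow (c - 1) = G.Xrow c
  hX'B : G'.Xrow c = G.Xrow (c - 1)
  hO' : ∀ k, k ≠ c - 1 → k ≠ c → G'.Orow k = G.Orow k
  hX' : ∀ k, k ≠ c - 1 → k ≠ c → G'.Xrow k = G.Xrow k

/-- Pentagon data in the 4-fold torus `T₄`: the underlying rectangle
`I₄(p)` of `𝔾₄`, the side of the curved edge (`left = true` means the curved
vertical edge is the east edge of the rectangle), and the lifted height `hh`
of the crossing point (`a` or `b`) serving as the fifth corner. -/
structure Pent (n : ℕ) where
  rect : Rect (2 * n)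
  left : Bool
  hh : ZMod (2 * n)
deriving DecidableEq

instance (n : ℕ) [NeZero n] : Fintype (Pent n) :=
  Fintype.ofEquiv (Rect (2 * n) × Bool × ZMod (2 * n))
    { toFun := fun p => ⟨p.1, p.2.1, p.2.2⟩
      invFun := fun p => ⟨p.rect, p.left, p.hh⟩
      left_inv := fun _ => rfl
      right_inv := fun _ => rfl }

/-- the distinguished vertical edge lies on a lift of the curved circle -/
def onCedge {n : ℕ} (C : CommData n) (p : Pent n) : Prop :=
  if p.left then pr p.rect.cE = C.c else pr p.rect.cW = C.c

/-- the crossing point (at height just below the row circle `h`) lies strictly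
inside the vertical extent of the rectangle -/
def heightOK {n : ℕ} (r : Rect (2 * n)) (h : ZMod (2 * n)) : Prop :=
  0 < (h - r.rS).val ∧ (h - r.rS).val ≤ (r.rN - r.rS).val

/-- a pentagon from `x₄ ∈ S₄(𝔾₄)` to `y₄' ∈ S₄(𝔾₄')` (with fifth corner at a
lift of the distinguished point `a`) -/
def IsPentA {n : ℕ} (C : CommData n) (x y' : GridState n) (p : Pent n) : Prop :=
  IsRect4From x y' p.rect ∧ pr p.hh = C.h₂ ∧ onCedge C p ∧ heightOK p.rect p.hh

/-- a pentagon from `y₄' ∈ S₄(𝔾₄')` to `x₄ ∈ S₄(𝔾₄)` (fifth corner at a lift of `b`) -/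
def IsPentB {n : ℕ} (C : CommData n) (y' x : GridState n) (p : Pent n) : Prop :=
  IsRect4From y' x p.rect ∧ pr p.hh = C.h₁ ∧ onCedge C p ∧ heightOK p.rect p.hh

/-- the rows along which the boundary of the pentagon runs along `γ` rather than `β_c` -/
def detourA {n : ℕ} [NeZero n] (p : Pent n) : Finset (ZMod (2 * n)) :=
  if p.left then Finset.univ.filter (fun j => inIco p.rect.rS p.hh j)
  else Finset.univ.filter (fun j => inIco p.hh p.rect.rN j)

def detourB {n : ℕ} [NeZero n] (p : Pent n) : Finset (ZMod (2 * n)) :=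
  if p.left then Finset.univ.filter (fun j => inIco p.hh p.rect.rN j)
  else Finset.univ.filter (fun j => inIco p.rect.rS p.hh j)

/-- marking-count correction along a curved edge: in a detour row `j`, if `γ` is
west (`π₄ j ∈ J`) the bigon sliver carries the column-`(c−1)` marking, otherwise
it carries the column-`c` marking; the sliver is gained or lost according to
whether the region lies east (`east = true`) or west of the curved circle. -/
def adj {n : ℕ} [NeZero n] (C : CommData n) (f : ZMod n → ZMod n) (east : Bool)
    (D : Finset (ZMod (2 * n))) (i : ZMod n) : ℤ :=
  ∑ j ∈ D,
    if inIco C.h₁ C.h₂ (pr j) then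
      (if i = C.c - 1 ∧ f (C.c - 1) = pr j then (if east then 1 else -1) else 0)
    else
      (if i = C.c ∧ f C.c = pr j then (if east then -1 else 1) else 0)

/-- `O_i[p₄]` for a pentagon counted by `P•` -/
def pentOA {n : ℕ} [NeZero n] (C : CommData n) (p : Pent n) (i : ZMod n) : ℤ :=
  (O4count C.G p.rect i : ℤ) + adj C C.G.Orow (!p.left) (detourA p) i

def pentXA {n : ℕ} [NeZero n] (C : CommData n) (p : Pent n) (i : ZMod n) : ℤ :=
  (X4count C.G p.rect i : ℤ) + adj C C.G.Xrow (!p.left) (detourA p) i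

def pentXDisjA {n : ℕ} [NeZero n] (C : CommData n) (p : Pent n) : Prop :=
  ∀ i, pentXA C p i = 0

def pentOB {n : ℕ} [NeZero n] (C : CommData n) (p : Pent n) (i : ZMod n) : ℤ :=
  (O4count C.G p.rect i : ℤ) + adj C C.G.Orow (!p.left) (detourB p) i

def pentXB {n : ℕ} [NeZero n] (C : CommData n) (p : Pent n) (i : ZMod n) : ℤ :=
  (X4count C.G p.rect i : ℤ) + adj C C.G.Xrow (!p.left) (detourB p) i

def pentXDisjB {n : ℕ} [NeZero n] (C : CommData n) (p : Pent n) : Prop :=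
  ∀ i, pentXB C p i = 0

/-- the weight `V₁^{O₁[p₄]}⋯V_n^{O_n[p₄]} v^{m[p₄]}`, with `m[p₄] = m[I₄(p₄)]` -/
def pentWtA {n : ℕ} [NeZero n] (C : CommData n) (x y' : GridState n) (p : Pent n) : Rng n :=
  (∏ i : ZMod n, Vv i ^ (pentOA C p i).toNat) * vV ^ m4 x y' p.rect

def pentWtB {n : ℕ} [NeZero n] (C : CommData n) (y' x : GridState n) (p : Pent n) : Rng n :=
  (∏ i : ZMod n, Vv i ^ (pentOB C p i).toNat) * vV ^ m4 y' x p.rect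

/-- the pentagon-counting map `P• : GC•(𝔾₄) → GC•(𝔾₄')` -/
def Pmap {n : ℕ} [NeZero n] (C : CommData n) : GC n →ₗ[Rng n] GC n :=
  basisMap fun x => ∑ y' : GridState n,
    ∑ p ∈ Finset.univ.filter (fun p : Pent n =>
        IsPentA C x y' p ∧ normal4 p.rect ∧ pentXDisjA C p),
      Finsupp.single y' (pentWtA C x y' p)

/-- the pentagon-counting map `(P•)' : GC•(𝔾₄') → GC•(𝔾₄)` -/
def P'map {n : ℕ} [NeZero n] (C : CommData n) : GC n →ₗ[Rng n] GC n :=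
  basisMap fun y' => ∑ x : GridState n,
    ∑ p ∈ Finset.univ.filter (fun p : Pent n =>
        IsPentB C y' x p ∧ normal4 p.rect ∧ pentXDisjB C p),
      Finsupp.single x (pentWtB C y' x p)

/-- Hexagon data: the underlying rectangle `I₄(h₄)` of `𝔾₄`, the side of its
curved edge, and the lifted heights of its two crossing-point corners
(`ha` a lift of `a`, `hb` a lift of `b`). -/
structure Hex (n : ℕ) where
  rect : Rect (2 * n)
  left : Bool
  ha : ZMod (2 * n)
  hb : ZMod (2 * n)
deriving DecidableEq

instance (n : ℕ) [NeZero n] : Fintype (Hex n) :=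
  Fintype.ofEquiv (Rect (2 * n) × Bool × ZMod (2 * n) × ZMod (2 * n))
    { toFun := fun p => ⟨p.1, p.2.1, p.2.2.1, p.2.2.2⟩
      invFun := fun p => ⟨p.rect, p.left, p.ha, p.hb⟩
      left_inv := fun _ => rfl
      right_inv := fun _ => rfl }

def onCedgeH {n : ℕ} (C : CommData n) (h : Hex n) : Prop :=
  if h.left then pr h.rect.cE = C.c else pr h.rect.cW = C.c

/-- a hexagon from `x₄` to `y₄` (both states of `𝔾₄`) -/
def IsHex {n : ℕ} (C : CommData n) (x y : GridState n) (h : Hex n) : Prop :=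
  IsRect4From x y h.rect ∧ pr h.ha = C.h₂ ∧ pr h.hb = C.h₁ ∧ onCedgeH C h ∧
  heightOK h.rect h.ha ∧ heightOK h.rect h.hb

/-- the rows between the two crossing-point corners of a hexagon -/
def detourH {n : ℕ} [NeZero n] (h : Hex n) : Finset (ZMod (2 * n)) :=
  if (h.ha - h.rect.rS).val < (h.hb - h.rect.rS).val then
    Finset.univ.filter (fun j => inIco h.ha h.hb j)
  else Finset.univ.filter (fun j => inIco h.hb h.ha j)

def hexO {n : ℕ} [NeZero n] (C : CommData n) (h : Hex n) (i : ZMod n) : ℤ :=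
  (O4count C.G h.rect i : ℤ) + adj C C.G.Orow (!h.left) (detourH h) i

def hexX {n : ℕ} [NeZero n] (C : CommData n) (h : Hex n) (i : ZMod n) : ℤ :=
  (X4count C.G h.rect i : ℤ) + adj C C.G.Xrow (!h.left) (detourH h) i

def hexXDisj {n : ℕ} [NeZero n] (C : CommData n) (h : Hex n) : Prop :=
  ∀ i, hexX C h i = 0

def hexWt {n : ℕ} [NeZero n] (C : CommData n) (x y : GridState n) (h : Hex n) : Rng n :=
  (∏ i : ZMod n, Vv i ^ (hexO C h i).toNat) * vV ^ m4 x y h.rect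

/-- the hexagon-counting map `H• : GC•(𝔾₄) → GC•(𝔾₄)` -/
def Hmap {n : ℕ} [NeZero n] (C : CommData n) : GC n →ₗ[Rng n] GC n :=
  basisMap fun x => ∑ y : GridState n,
    ∑ h ∈ Finset.univ.filter (fun h : Hex n =>
        IsHex C x y h ∧ normal4 h.rect ∧ hexXDisj C h),
      Finsupp.single y (hexWt C x y h)

/-! ### Double-point enhanced grid homology -/

def cycles {n : ℕ} [NeZero n] (G : GridDiagram n) : Submodule (Rng n) (GC n) :=
  LinearMap.ker (diffB G)

def bdrIn {n : ℕ} [NeZero n] (G : GridDiagram n) : Submodule (Rng n) ↥(cycles G) :=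
  Submodule.comap (cycles G).subtype (LinearMap.range (diffB G))

instance GHquotInst {n : ℕ} [NeZero n] (G : GridDiagram n) :
    HasQuotient ↥(cycles G) (Submodule (Rng n) ↥(cycles G)) :=
  Submodule.hasQuotient (R := Rng n) (M := ↥(cycles G))

/-- the double-point enhanced grid homology `GH•(𝔾)` -/
abbrev GH {n : ℕ} [NeZero n] (G : GridDiagram n) := ↥(cycles G) ⧸ bdrIn G

/-- a homology class is homogeneous of degree `(d,s)` if it has a homogeneous
cycle representative -/
def GHhomog {n : ℕ} [NeZero n] (G : GridDiagram n) (h : GH G) (d s : ℚ) : Prop :=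
  ∃ w : ↥(cycles G), (Submodule.Quotient.mk (R := Rng n) (M := ↥(cycles G)) w : GH G) = h ∧ IsHomog G (w : GC n) d s

/-! ### Commutation and stabilization moves as relations on grid diagrams -/

/-- `𝔾` and `𝔾'` differ by a column commutation move -/
def IsColComm {n : ℕ} (G G' : GridDiagram n) : Prop :=
  ∃ C : CommData n, C.G = G ∧ C.G' = G'

/-- the transposed grid diagram (exchanging the roles of rows and columns) -/
def GridDiagram.transpose {n : ℕ} (G : GridDiagram n) : GridDiagram n where
  Orow := ⇑(Equiv.ofBijective G.Orow G.hO).symm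
  Xrow := ⇑(Equiv.ofBijective G.Xrow G.hX).symm
  hO := (Equiv.ofBijective G.Orow G.hO).symm.bijective
  hX := (Equiv.ofBijective G.Xrow G.hX).symm.bijective
  hOX := by
    intro i h
    apply G.hOX ((Equiv.ofBijective G.Orow G.hO).symm i)
    have h1 : G.Orow ((Equiv.ofBijective G.Orow G.hO).symm i) = i :=
      Equiv.ofBijective_apply_symm_apply G.Orow G.hO i
    have h2 : G.Xrow ((Equiv.ofBijective G.Xrow G.hX).symm i) = i :=
      Equiv.ofBijective_apply_symm_apply G.Xrow G.hX i
    rw [h1, h, h2]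

/-- `𝔾` and `𝔾'` differ by a row commutation move -/
def IsRowComm {n : ℕ} (G G' : GridDiagram n) : Prop :=
  IsColComm G.transpose G'.transpose

/-- collapse map identifying `a` and `a+1` (used to destabilize) -/
def coll {n : ℕ} (a k : ZMod (n + 1)) : ZMod n :=
  (a.val : ZMod n) + (((k - a).val - 1 : ℕ) : ZMod n)

/-- `𝔾'` is obtained from `𝔾` by a stabilization with new 2×2 block at columns
`c', c'+1` and rows `r', r'+1`; the empty square of the block sits at the corner
selected by `(ec, er)` (east column?, north row?), and `xty` records whether the
block carries two `X`-markings (type `X:·`) or two `O`-markings (type `O:·`).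
E.g. `(ec, er, xty) = (false, false, true)` is type `X:SW`, with
`O₁ = (c'+1, r'+1)`, `X₁ = (c', r'+1)`, `X₂ = (c'+1, r')`. -/
def IsStabAt {n : ℕ} (G : GridDiagram n) (G' : GridDiagram (n + 1))
    (c' r' : ZMod (n + 1)) (ec er xty : Bool) : Prop :=
  (if xty then
    G'.Orow (if ec then c' else c' + 1) = (if er then r' else r' + 1) ∧
    G'.Xrow (if ec then c' + 1 else c') = (if er then r' else r' + 1) ∧
    G'.Xrow (if ec then c' else c' + 1) = (if er then r' + 1 else r') ∧
    G.Xrow (c'.val : ZMod n) = (r'.val : ZMod n) ∧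
    G.Orow (c'.val : ZMod n) = coll r' (G'.Orow (if ec then c' + 1 else c'))
  else
    G'.Xrow (if ec then c' else c' + 1) = (if er then r' else r' + 1) ∧
    G'.Orow (if ec then c' + 1 else c') = (if er then r' else r' + 1) ∧
    G'.Orow (if ec then c' else c' + 1) = (if er then r' + 1 else r') ∧
    G.Orow (c'.val : ZMod n) = (r'.val : ZMod n) ∧
    G.Xrow (c'.val : ZMod n) = coll r' (G'.Xrow (if ec then c' + 1 else c'))) ∧
  (∀ k : ZMod (n + 1), k ≠ c' → k ≠ c' + 1 →
    G.Orow (coll c' k) = coll r' (G'.Orow k) ∧ G.Xrow (coll c' k) = coll r' (G'.Xrow k))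

/-- `𝔾'` is obtained from `𝔾` by a stabilization move of one of the standard types -/
def IsStab {n : ℕ} (G : GridDiagram n) (G' : GridDiagram (n + 1)) : Prop :=
  ∃ c' r' ec er xty, IsStabAt G G' c' r' ec er xty

/-! ### The stabilization machinery (type `X:SW`) for the 4-fold complexes -/

/-- projection of `GC•(𝔾₄')` onto the span `I₄` of states containing the
distinguished point `c = (c'+1, r'+1)` -/
def pI {n : ℕ} (c' r' : ZMod (n + 1)) : GC (n + 1) →ₗ[Rng (n + 1)] GC (n + 1) :=
  basisMap fun x => if x (c' + 1) = r' + 1 then Finsupp.single x 1 else 0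

/-- projection onto the complementary span `N₄` -/
def pN {n : ℕ} (c' r' : ZMod (n + 1)) : GC (n + 1) →ₗ[Rng (n + 1)] GC (n + 1) :=
  basisMap fun x => if x (c' + 1) = r' + 1 then 0 else Finsupp.single x 1

/-- the submodule `I₄` -/
def Isub {n : ℕ} (c' r' : ZMod (n + 1)) : Submodule (Rng (n + 1)) (GC (n + 1)) :=
  Finsupp.supported (Rng (n + 1)) (Rng (n + 1)) {x : GridState (n + 1) | x (c' + 1) = r' + 1}

/-- the submodule `N₄` -/
def Nsub {n : ℕ} (c' r' : ZMod (n + 1)) : Submodule (Rng (n + 1)) (GC (n + 1)) :=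
  Finsupp.supported (Rng (n + 1)) (Rng (n + 1)) {x : GridState (n + 1) | x (c' + 1) ≠ r' + 1}

/-- the components `∂_{I₄}^{I₄}`, `∂_{I₄}^{N₄}`, `∂_{N₄}^{N₄}` of `∂₄•` -/
def dII {n : ℕ} [NeZero (n + 1)] (G' : GridDiagram (n + 1)) (c' r' : ZMod (n + 1)) :
    GC (n + 1) →ₗ[Rng (n + 1)] GC (n + 1) :=
  pI c' r' ∘ₗ diff4 G' ∘ₗ pI c' r'

def dIN {n : ℕ} [NeZero (n + 1)] (G' : GridDiagram (n + 1)) (c' r' : ZMod (n + 1)) :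
    GC (n + 1) →ₗ[Rng (n + 1)] GC (n + 1) :=
  pN c' r' ∘ₗ diff4 G' ∘ₗ pI c' r'

def dNN {n : ℕ} [NeZero (n + 1)] (G' : GridDiagram (n + 1)) (c' r' : ZMod (n + 1)) :
    GC (n + 1) →ₗ[Rng (n + 1)] GC (n + 1) :=
  pN c' r' ∘ₗ diff4 G' ∘ₗ pN c' r'

/-- section of the column collapse map, avoiding the new column `c'+1` -/
def sect {n : ℕ} (a : ZMod (n + 1)) (k : ZMod n) : ZMod (n + 1) :=
  a + (if k - (a.val : ZMod n) = 0 then 0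
       else (((k - (a.val : ZMod n)).val + 1 : ℕ) : ZMod (n + 1)))

def stCollFun {n : ℕ} (c' r' : ZMod (n + 1)) (x : GridState (n + 1)) :
    ZMod n → ZMod n :=
  fun k => coll r' (x (sect c' k))

/-- the destabilized grid state `x` corresponding to `x' = x ∪ {c}` -/
def stColl {n : ℕ} (c' r' : ZMod (n + 1)) (x : GridState (n + 1)) : GridState n :=
  if h : Function.Bijective (stCollFun c' r' x) then Equiv.ofBijective _ h else 1

/-- the promoted module `GC•(𝔾₄)[V₁]`: the free `𝔽[V₁,…,V_n,v]`-module on the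
grid states of the destabilized diagram -/
abbrev GCP (n : ℕ) := GridState n →₀ Rng (n + 1)

def basisMapP {n : ℕ} (f : GridState n → GCP n) : GCP n →ₗ[Rng (n + 1)] GCP n :=
  Finsupp.lsum (Rng (n + 1)) fun x => LinearMap.toSpanSingleton (Rng (n + 1)) (GCP n) (f x)

/-- the identification `e₄` (extended by zero on `N₄`) -/
def e4map {n : ℕ} (c' r' : ZMod (n + 1)) : GC (n + 1) →ₗ[Rng (n + 1)] GCP n :=
  Finsupp.lsum (Rng (n + 1)) fun x =>
    LinearMap.toSpanSingleton (Rng (n + 1)) (GCP n)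
      (if x (c' + 1) = r' + 1 then Finsupp.single (stColl c' r' x) (1 : Rng (n + 1)) else 0)

/-- renaming of the variables of the destabilized diagram into those of `𝔾'` -/
def renUp {n : ℕ} (c' : ZMod (n + 1)) : Rng n →+* Rng (n + 1) :=
  (MvPolynomial.rename (Option.map (sect c')) :
      MvPolynomial (Option (ZMod n)) F →ₐ[F] MvPolynomial (Option (ZMod (n + 1))) F).toRingHom

/-- the differential of the promoted complex `GC•(𝔾₄)[V₁]` -/
def diffP {n : ℕ} [NeZero n] (G : GridDiagram n) (c' : ZMod (n + 1)) :
    GCP n →ₗ[Rng (n + 1)] GCP n :=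
  basisMapP fun x => ∑ y : GridState n,
    ∑ r ∈ Finset.univ.filter
        (fun r : Rect (2 * n) => IsRect4From x y r ∧ normal4 r ∧ XDisjoint4 G r),
      Finsupp.single y (renUp c' (wt4 G x y r))

/-- homogeneity on the promoted complex -/
def IsHomogP {n : ℕ} [NeZero n] (G : GridDiagram n) (z : GCP n) (d s : ℚ) : Prop :=
  ∀ (y : GridState n) (k : Option (ZMod (n + 1)) →₀ ℕ), MvPolynomial.coeff k (z y) ≠ 0 →
    (MaslovO G y - 2 * ∑ i : ZMod (n + 1), (k (some i) : ℚ) + 2 * (k none : ℚ) = d) ∧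
    (Alex G y - ∑ i : ZMod (n + 1), (k (some i) : ℚ) = s)

/-- the map counting equivalence classes of rectangles crossing `X₂` (the
`X`-marking of column `c'+1`) once and no other `X`-marking -/
def HX2map {n : ℕ} (G' : GridDiagram (n + 1)) (c' : ZMod (n + 1)) :
    GC (n + 1) →ₗ[Rng (n + 1)] GC (n + 1) :=
  basisMap fun x => ∑ y : GridState (n + 1),
    ∑ r ∈ Finset.univ.filter (fun r : Rect (2 * (n + 1)) =>
        IsRect4From x y r ∧ normal4 r ∧ X4count G' r (c' + 1) = 1 ∧
        ∀ k, k ≠ c' + 1 → X4count G' r k = 0),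
      Finsupp.single y (wt4 G' x y r)

/-- its component `𝓗_{X₂}^{I₄} : N₄ → I₄` -/
def hX2I {n : ℕ} (G' : GridDiagram (n + 1)) (c' r' : ZMod (n + 1)) :
    GC (n + 1) →ₗ[Rng (n + 1)] GC (n + 1) :=
  pI c' r' ∘ₗ HX2map G' c' ∘ₗ pN c' r'

/-- weight with the variable `V_j` evaluated at `1` -/
def wtNo {n : ℕ} [NeZero n] (G : GridDiagram n) (x y : GridState n) (j : ZMod n)
    (r : Rect (2 * n)) : Rng n :=
  (∏ i ∈ Finset.univ.erase j, Vv i ^ O4count G r i) * vV ^ m4 x y r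

/-- `𝓗_{O₁}•`: counts `X`-disjoint rectangles crossing `O₁` (the `O`-marking of
column `c'+1`) once, with `V₁` evaluated at `1` -/
def HO1map {n : ℕ} (G' : GridDiagram (n + 1)) (c' : ZMod (n + 1)) :
    GC (n + 1) →ₗ[Rng (n + 1)] GC (n + 1) :=
  basisMap fun x => ∑ y : GridState (n + 1),
    ∑ r ∈ Finset.univ.filter (fun r : Rect (2 * (n + 1)) =>
        IsRect4From x y r ∧ normal4 r ∧ XDisjoint4 G' r ∧ O4count G' r (c' + 1) = 1),
      Finsupp.single y (wtNo G' x y (c' + 1) r)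

/-- its component `I₄ → N₄` -/
def hO1N {n : ℕ} (G' : GridDiagram (n + 1)) (c' r' : ZMod (n + 1)) :
    GC (n + 1) →ₗ[Rng (n + 1)] GC (n + 1) :=
  pN c' r' ∘ₗ HO1map G' c' ∘ₗ pI c' r'

/-! ### Grid diagrams of arbitrary size, and the moves of Cromwell's theorem -/

/-- a grid diagram of unspecified (positive) grid number -/
structure GDS where
  sz : ℕ+
  D : GridDiagram (sz : ℕ)

instance (p : ℕ+) : NeZero (p : ℕ) := ⟨p.ne_zero⟩

/-- a single commutation or stabilization move -/
def MoveRel (A B : GDS) : Prop :=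
  (∃ h : (A.sz : ℕ) = (B.sz : ℕ),
      IsColComm (h ▸ A.D) B.D ∨ IsRowComm (h ▸ A.D) B.D) ∨
  (∃ h : (B.sz : ℕ) = (A.sz : ℕ) + 1, IsStab A.D (h ▸ B.D))

/-- connected by a finite sequence of commutation moves and
stabilization/destabilization moves -/
def ConnectedByMoves (A B : GDS) : Prop :=
  Relation.ReflTransGen (fun X Y => MoveRel X Y ∨ MoveRel Y X) A B

section
set_option linter.unusedSectionVars false
open Finset

/-- one-dimensional multiplicity: number of `j < w` with `a + j = k` -/
def kap {n : ℕ} (a : ZMod n) (w : ℕ) (k : ZMod n) : ℕ :=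
  ∑ j ∈ range w, if a + (j : ZMod n) = k then 1 else 0

lemma kap_add {n : ℕ} (a : ZMod n) (w₁ w₂ : ℕ) (k : ZMod n) :
    kap a (w₁ + w₂) k = kap a w₁ k + kap (a + (w₁ : ZMod n)) w₂ k := by
  unfold kap
  rw [Finset.sum_range_add]
  congr 1
  apply Finset.sum_congr rfl
  intro j _
  push_cast
  rw [add_assoc]

lemma kap_succ {n : ℕ} (a : ZMod n) (w : ℕ) (k : ZMod n) :
    kap a (w + 1) k = kap a w k + if a + (w : ZMod n) = k then 1 else 0 := by
  unfold kap
  rw [Finset.sum_range_succ]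

lemma kap_zero {n : ℕ} (a k : ZMod n) : kap a 0 k = 0 := by simp [kap]

lemma kap_one {n : ℕ} (a k : ZMod n) : kap a 1 k = if a = k then 1 else 0 := by
  have := kap_succ a 0 k
  simpa [kap_zero] using this

lemma kap_diff {n : ℕ} (a : ZMod n) (w : ℕ) (k : ZMod n) :
    (kap a w k : ℚ) = kap a w (k - 1) + (if k = a then 1 else 0) -
      (if k = a + w then 1 else 0) := by
  induction w with
  | zero => simp [kap_zero]
  | succ w ih =>
    rw [kap_succ, kap_succ]
    push_cast
    rw [ih]
    have h1 : (a + (w : ZMod n) = k) ↔ (k = a + w) := eq_comm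
    have h2 : (a + (w : ZMod n) = k - 1) ↔ (k = a + (w + 1)) := by
      rw [eq_sub_iff_add_eq, add_assoc, eq_comm]
    simp only [h1, h2]
    ring

lemma kap_shift {n : ℕ} (a : ZMod n) (w : ℕ) :
    kap a w (a + w) + (if (w : ZMod n) = 0 then 0 else 1) = kap a w a := by
  have h : ∀ v : ℕ, kap a v (a + v) + 1 = kap a v a + if (v : ZMod n) = 0 then 1 else 0 := by
    intro v
    have e1 : kap a v (a + v) = ∑ j ∈ range v, if ((j + 1 : ℕ) : ZMod n) = 0 then 1 else 0 := by
      unfold kap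
      rw [← Finset.sum_range_reflect]
      apply Finset.sum_congr rfl
      intro j hj
      have hj' := Finset.mem_range.1 hj
      have : ((v - 1 - j : ℕ) : ZMod n) = (v : ZMod n) - 1 - j := by
        rw [Nat.cast_sub (by omega), Nat.cast_sub (by omega)]; simp
      rw [this]
      apply if_congr _ rfl rfl
      push_cast
      constructor
      · intro hh
        linear_combination -hh
      · intro hh
        linear_combination -hh
    have e2 : kap a v a = ∑ j ∈ range v, if (j : ZMod n) = 0 then 1 else 0 := by
      unfold kap; simp
    rw [e1, e2, ← Finset.sum_range_succ, Finset.sum_range_succ']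
    simp
  have := h w
  split_ifs at * <;> omega

variable {n : ℕ} [NeZero n]

lemma sum_kap (a : ZMod n) (w : ℕ) : ∑ k, kap a w k = w := by
  unfold kap
  rw [Finset.sum_comm]
  simp

lemma sum_range_zmod {M : Type*} [AddCommMonoid M] (m : ℕ) [NeZero m] (f : ZMod m → M) :
    ∑ k, f k = ∑ j ∈ range m, f (j : ZMod m) := by
  refine Finset.sum_bij' (fun k _ => k.val) (fun j _ => (j : ZMod m)) ?_ ?_ ?_ ?_ ?_
  · intro k _; exact Finset.mem_range.2 (ZMod.val_lt k)
  · intro j _; exact Finset.mem_univ _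
  · intro k _; simp
  · intro j hj; exact ZMod.val_cast_of_lt (Finset.mem_range.1 hj)
  · intro k _; simp

lemma kap_full (a k : ZMod n) : kap a n k = 1 := by
  unfold kap
  rw [← sum_range_zmod n (fun j => if a + j = k then 1 else 0)]
  have : ∀ j : ZMod n, (a + j = k) ↔ (j = k - a) := by
    intro j; constructor
    · rintro rfl; ring
    · rintro rfl; ring
  simp [this]

lemma kap_mono (a : ZMod n) {w w' : ℕ} (h : w ≤ w') (k : ZMod n) : kap a w k ≤ kap a w' k := by
  obtain ⟨d, rfl⟩ := Nat.exists_eq_add_of_le h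
  rw [kap_add]; omega

lemma kap_ge_one (a : ZMod n) {w : ℕ} (h : n ≤ w) (k : ZMod n) : 1 ≤ kap a w k := by
  rw [← kap_full a k]; exact kap_mono a h k

lemma kap_ge_two (a : ZMod n) {w : ℕ} (h : 2 * n ≤ w) (k : ZMod n) : 2 ≤ kap a w k := by
  have := kap_mono a h k
  rw [two_mul, kap_add, kap_full, kap_full] at this
  exact this

/-- symmetrized (point) multiplicity -/
def ph (a : ZMod n) (w : ℕ) (k : ZMod n) : ℚ := ((kap a w (k - 1) : ℚ) + kap a w k) / 2

lemma ph_eq (a : ZMod n) (w : ℕ) (k : ZMod n) :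
    ph a w k = kap a w k - (if k = a then 1 else 0) / 2 + (if k = a + w then 1 else 0) / 2 := by
  unfold ph
  have := kap_diff a w k
  linear_combination (-1/2) * this

lemma ph_antisymm_aux (a a' : ZMod n) (w w' : ℕ) :
    ph a' w' (a + w) - ph a' w' a =
      (∑ j ∈ range w, ∑ i ∈ range w', ((if a' + (i : ZMod n) = a + j + 1 then (1 : ℚ) else 0) -
        (if a' + (i : ZMod n) + 1 = a + j then (1 : ℚ) else 0))) / 2 := by
  have h : ph a' w' (a + w) - ph a' w' a =
      ∑ j ∈ range w, (ph a' w' (a + (j + 1 : ℕ)) - ph a' w' (a + (j : ℕ))) := by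
    rw [Finset.sum_range_sub (fun j => ph a' w' (a + (j : ℕ)))]
    simp
  rw [h, Finset.sum_div]
  apply Finset.sum_congr rfl
  intro j _
  unfold ph kap
  push_cast
  rw [Finset.sum_sub_distrib]
  have e1 : a + ((j : ZMod n) + 1) - 1 = a + j := by ring
  have e2 : ∀ i : ℕ, (a' + (i : ZMod n) = a + j - 1) ↔ (a' + (i : ZMod n) + 1 = a + j) := by
    intro i; exact eq_sub_iff_add_eq
  simp only [e1, e2, add_assoc]
  ring

lemma ph_antisymm (a a' : ZMod n) (w w' : ℕ) :
    ph a' w' (a + w) - ph a' w' a = - (ph a w (a' + w') - ph a w a') := by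
  rw [ph_antisymm_aux, ph_antisymm_aux, Finset.sum_comm, ← neg_div, ← Finset.sum_neg_distrib]
  congr 1
  apply Finset.sum_congr rfl
  intro j _
  rw [← Finset.sum_neg_distrib]
  apply Finset.sum_congr rfl
  intro i _
  simp only [eq_comm (a := a + (i : ZMod n) + 1), eq_comm (a := a + (i : ZMod n))]
  ring

lemma sum_ph (a : ZMod n) (w : ℕ) : ∑ k, ph a w k = w := by
  unfold ph
  rw [← Finset.sum_div, Finset.sum_add_distrib]
  have h1 : ∑ k, (kap a w k : ℚ) = w := by exact_mod_cast sum_kap a w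
  have h2 : ∑ k, (kap a w (k - 1) : ℚ) = w := by
    rw [← h1]
    exact (Equiv.subRight (1 : ZMod n)).sum_comp (fun k => (kap a w k : ℚ))
  rw [h1, h2]; ring

/-! ### Rectangles -/

/-- combinatorial rectangle: start column, width, start row, height -/
@[ext] structure Rc (n : ℕ) where
  a : ZMod n
  w : ℕ
  s : ZMod n
  h : ℕ

def RS (n : ℕ) [NeZero n] : Finset (Rc n) :=
  ((univ : Finset (ZMod n)) ×ˢ range (2 * n) ×ˢ (univ : Finset (ZMod n)) ×ˢ range (2 * n)).image
    fun p => ⟨p.1, p.2.1, p.2.2.1, p.2.2.2⟩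

lemma mem_RS (r : Rc n) : r ∈ RS n ↔ r.w < 2 * n ∧ r.h < 2 * n := by
  unfold RS
  simp only [Finset.mem_image, Finset.mem_product, Finset.mem_univ, Finset.mem_range, true_and]
  constructor
  · rintro ⟨p, ⟨h1, h2⟩, rfl⟩; exact ⟨h1, h2⟩
  · rintro ⟨h1, h2⟩; exact ⟨(r.a, r.w, r.s, r.h), ⟨h1, h2⟩, rfl⟩

/-- local multiplicity of the rectangle on the torus -/
def Rc.dom (r : Rc n) (i k : ZMod n) : ℕ := kap r.a r.w i * kap r.s r.h k

/-- `r` is a rectangle starting at the state `x` -/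
def IsR (x : GridState n) (r : Rc n) : Prop :=
  x r.a = r.s ∧ x (r.a + r.w) = r.s + r.h ∧ (r.w : ZMod n) ≠ 0

/-- terminal state -/
def tgt (x : GridState n) (r : Rc n) : GridState n := (Equiv.swap r.a (r.a + r.w)).trans x

lemma IsR.ne {x : GridState n} {r : Rc n} (h : IsR x r) : r.a ≠ r.a + r.w := by
  intro e; exact h.2.2 (by simpa using e)

lemma IsR.hne {x : GridState n} {r : Rc n} (h : IsR x r) : (r.h : ZMod n) ≠ 0 := by
  intro e
  have := h.2.1
  rw [e, add_zero, ← h.1] at this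
  exact h.ne (x.injective this).symm

lemma IsR.w_pos {x : GridState n} {r : Rc n} (h : IsR x r) : 0 < r.w := by
  rcases Nat.eq_zero_or_pos r.w with e | e
  · exact absurd (by rw [e]; simp) h.2.2
  · exact e

lemma IsR.h_pos {x : GridState n} {r : Rc n} (h : IsR x r) : 0 < r.h := by
  rcases Nat.eq_zero_or_pos r.h with e | e
  · exact absurd (by rw [e]; simp) h.hne
  · exact e

lemma tgt_a {x : GridState n} {r : Rc n} (h : IsR x r) : tgt x r r.a = r.s + r.h := by
  simp [tgt, h.2.1]

lemma tgt_b {x : GridState n} {r : Rc n} (h : IsR x r) : tgt x r (r.a + r.w) = r.s := by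
  simp [tgt, h.1]

lemma tgt_o {x : GridState n} {r : Rc n} {k : ZMod n} (h1 : k ≠ r.a) (h2 : k ≠ r.a + r.w) :
    tgt x r k = x k := by
  simp [tgt, Equiv.swap_apply_of_ne_of_ne h1 h2]

/-- splitting a sum over columns -/
lemma sum_split (a b : ZMod n) (hab : a ≠ b) {M : Type*} [AddCommMonoid M] (f : ZMod n → M) :
    ∑ k, f k = f a + f b + ∑ k, if k = a ∨ k = b then 0 else f k := by
  have : ∀ k, f k = (if k = a then f a else 0) + (if k = b then f b else 0) +
      if k = a ∨ k = b then 0 else f k := by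
    intro k
    by_cases h1 : k = a
    · subst h1; simp [hab]
    · by_cases h2 : k = b
      · subst h2; simp [h1]
      · simp [h1, h2]
  conv_lhs => rw [Finset.sum_congr rfl (fun k _ => this k)]
  simp [Finset.sum_add_distrib]

lemma sum_tgt {x : GridState n} {r : Rc n} (h : IsR x r) (F : ZMod n → ZMod n → ℚ) :
    ∑ k, F k (tgt x r k) = ∑ k, F k (x k) + F r.a (r.s + r.h) + F (r.a + r.w) r.s
      - F r.a r.s - F (r.a + r.w) (r.s + r.h) := by
  rw [sum_split r.a (r.a + r.w) h.ne (fun k => F k (tgt x r k)),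
    sum_split r.a (r.a + r.w) h.ne (fun k => F k (x k))]
  have : ∀ k, (if k = r.a ∨ k = r.a + r.w then 0 else F k (tgt x r k)) =
      (if k = r.a ∨ k = r.a + r.w then 0 else F k (x k)) := by
    intro k
    split_ifs with hk
    · rfl
    · push Not at hk
      rw [tgt_o hk.1 hk.2]
  rw [Finset.sum_congr rfl (fun k _ => this k), tgt_a h, tgt_b h, h.1, h.2.1]
  ring

/-- point measure -/
def pmc (u : ZMod n → ZMod n) (r : Rc n) : ℚ := ∑ k, ph r.a r.w k * ph r.s r.h (u k)

/-- number of double points -/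
def mc (x : GridState n) (r : Rc n) : ℕ :=
  (∑ k, if k = r.a ∨ k = r.a + r.w then 0 else kap r.a r.w k * kap r.s r.h (x k)) +
    2 * kap r.a r.w (r.a + r.w) * kap r.s r.h (r.s + r.h) +
    kap r.a r.w (r.a + r.w) + kap r.s r.h (r.s + r.h)

lemma mc_eq {x : GridState n} {r : Rc n} (h : IsR x r) :
    2 * (mc x r : ℚ) = pmc x r + pmc (tgt x r) r - 1 := by
  have hs := sum_tgt h (fun k l => ph r.a r.w k * ph r.s r.h l)
  unfold pmc
  rw [hs, sum_split r.a (r.a + r.w) h.ne (fun k => ph r.a r.w k * ph r.s r.h (x k)), h.1, h.2.1]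
  have hne := h.ne
  have hk := kap_shift r.a r.w
  have hl := kap_shift r.s r.h
  rw [if_neg h.2.2] at hk
  rw [if_neg h.hne] at hl
  have hne' : r.s ≠ r.s + r.h := by intro e; exact h.hne (by simpa using e)
  have a1 : ph r.a r.w r.a = kap r.a r.w (r.a + r.w) + 1 / 2 := by
    rw [ph_eq, ← hk]; simp [h.2.2]; ring
  have a2 : ph r.a r.w (r.a + r.w) = kap r.a r.w (r.a + r.w) + 1 / 2 := by
    rw [ph_eq]; simp [h.2.2]
  have b1 : ph r.s r.h r.s = kap r.s r.h (r.s + r.h) + 1 / 2 := by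
    rw [ph_eq, ← hl]; simp [h.hne]; ring
  have b2 : ph r.s r.h (r.s + r.h) = kap r.s r.h (r.s + r.h) + 1 / 2 := by
    rw [ph_eq]; simp [h.hne]
  have hsum : (∑ k, if k = r.a ∨ k = r.a + r.w then 0 else ph r.a r.w k * ph r.s r.h (x k)) =
      ((∑ k, if k = r.a ∨ k = r.a + r.w then 0 else kap r.a r.w k * kap r.s r.h (x k) : ℕ) : ℚ) := by
    push_cast
    apply Finset.sum_congr rfl
    intro k _
    split_ifs with hk
    · simp
    · push Not at hk
      have h1 : x k ≠ r.s := by rw [← h.1]; exact fun e => hk.1 (x.injective e)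
      have h2 : x k ≠ r.s + r.h := by rw [← h.2.1]; exact fun e => hk.2 (x.injective e)
      rw [ph_eq, ph_eq]; simp [hk.1, hk.2, h1, h2]
  rw [hsum, a1, a2, b1, b2]
  unfold mc
  push_cast
  ring

/-- point measure of a domain -/
def pmD (u : ZMod n → ZMod n) (D : ZMod n → ZMod n → ℕ) : ℚ :=
  ∑ k, ((D (k - 1) (u k - 1) : ℚ) + D k (u k - 1) + D (k - 1) (u k) + D k (u k)) / 4

lemma pmD_add (u : ZMod n → ZMod n) (r₁ r₂ : Rc n) :
    pmD u (fun i k => r₁.dom i k + r₂.dom i k) = pmc u r₁ + pmc u r₂ := by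
  unfold pmD pmc
  rw [← Finset.sum_add_distrib]
  apply Finset.sum_congr rfl
  intro k _
  unfold Rc.dom ph
  push_cast
  ring

lemma mc_add {x : GridState n} {r₁ r₂ : Rc n} (h₁ : IsR x r₁) (h₂ : IsR (tgt x r₁) r₂) :
    2 * ((mc x r₁ + mc (tgt x r₁) r₂ : ℕ) : ℚ) =
      pmD x (fun i k => r₁.dom i k + r₂.dom i k) +
      pmD (tgt (tgt x r₁) r₂) (fun i k => r₁.dom i k + r₂.dom i k) - 2 := by
  rw [pmD_add, pmD_add]
  push_cast
  rw [mul_add, mc_eq h₁, mc_eq h₂]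
  have e1 : pmc (tgt x r₁) r₂ = _ := sum_tgt h₁ (fun k l => ph r₂.a r₂.w k * ph r₂.s r₂.h l)
  have e2 : pmc (tgt (tgt x r₁) r₂) r₁ = _ :=
    sum_tgt h₂ (fun k l => ph r₁.a r₁.w k * ph r₁.s r₁.h l)
  have f1 := ph_antisymm r₁.a r₂.a r₁.w r₂.w
  have f2 := ph_antisymm r₁.s r₂.s r₁.h r₂.h
  have g1 : pmc x r₂ = ∑ k, ph r₂.a r₂.w k * ph r₂.s r₂.h (x k) := rfl
  have g2 : pmc (tgt x r₁) r₁ = ∑ k, ph r₁.a r₁.w k * ph r₁.s r₁.h (tgt x r₁ k) := rfl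
  rw [← g1] at e1
  rw [← g2] at e2
  have key : (ph r₂.a r₂.w (r₁.a + r₁.w) - ph r₂.a r₂.w r₁.a) *
      (ph r₂.s r₂.h (r₁.s + r₁.h) - ph r₂.s r₂.h r₁.s) =
      (ph r₁.a r₁.w (r₂.a + r₂.w) - ph r₁.a r₁.w r₂.a) *
      (ph r₁.s r₁.h (r₂.s + r₂.h) - ph r₁.s r₁.h r₂.s) := by
    rw [f1, f2]; ring
  linear_combination e1 - e2 - key

end

section
set_option linter.unusedSectionVars false
open Finset
variable {n : ℕ} [NeZero n]

/-- composable pair of rectangles -/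
def CP (x : GridState n) (p : Rc n × Rc n) : Prop := IsR x p.1 ∧ IsR (tgt x p.1) p.2

/-- the two rectangles do not share both columns -/
def NB (p : Rc n × Rc n) : Prop :=
  ¬ (p.1.a + p.1.w = p.2.a ∧ p.1.a = p.2.a + p.2.w) ∧
  ¬ (p.1.a = p.2.a ∧ p.1.a + p.1.w = p.2.a + p.2.w)

/-- same domain and same end state -/
def PE (x : GridState n) (p p' : Rc n × Rc n) : Prop :=
  tgt (tgt x p.1) p.2 = tgt (tgt x p'.1) p'.2 ∧
  ∀ i k, p.1.dom i k + p.2.dom i k = p'.1.dom i k + p'.2.dom i k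


/-- the involution on pairs -/
def gi (p : Rc n × Rc n) : Rc n × Rc n :=
  if p.1.a + p.1.w = p.2.a then
    if p.1.h < p.2.h then
      (⟨p.2.a, p.2.w, p.1.s + p.1.h, p.2.h - p.1.h⟩, ⟨p.1.a, p.1.w + p.2.w, p.1.s, p.1.h⟩)
    else (⟨p.1.a, p.1.w + p.2.w, p.1.s, p.2.h⟩, ⟨p.1.a, p.1.w, p.1.s + p.2.h, p.1.h - p.2.h⟩)
  else if p.1.a + p.1.w = p.2.a + p.2.w then
    if p.1.w < p.2.w then
      (⟨p.2.a, p.2.w - p.1.w, p.2.s, p.2.h⟩, ⟨p.1.a, p.1.w, p.2.s, p.1.h + p.2.h⟩)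
    else (⟨p.2.a, p.2.w, p.2.s, p.1.h + p.2.h⟩, ⟨p.1.a, p.1.w - p.2.w, p.1.s, p.1.h⟩)
  else if p.1.a = p.2.a then
    if p.1.w < p.2.w then
      (⟨p.1.a + p.1.w, p.2.w - p.1.w, p.2.s, p.2.h⟩, ⟨p.1.a, p.1.w, p.1.s, p.1.h + p.2.h⟩)
    else (⟨p.1.a, p.2.w, p.1.s, p.1.h + p.2.h⟩, ⟨p.1.a + p.2.w, p.1.w - p.2.w, p.1.s, p.1.h⟩)
  else if p.1.a = p.2.a + p.2.w then
    if p.1.h < p.2.h then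
      (⟨p.2.a, p.2.w, p.2.s, p.2.h - p.1.h⟩, ⟨p.2.a, p.2.w + p.1.w, p.1.s, p.1.h⟩)
    else (⟨p.2.a, p.1.w + p.2.w, p.2.s, p.2.h⟩, ⟨p.1.a, p.1.w, p.1.s, p.1.h - p.2.h⟩)
  else (p.2, p.1)

/-- transfer statement for a replacement `p ↦ q` of pairs -/
def Tr (x : GridState n) (p q : Rc n × Rc n) : Prop :=
  CP x q ∧ NB q ∧ PE x p q ∧ gi p = q

lemma cast_pos_of_ne {w : ℕ} (h : (w : ZMod n) ≠ 0) : 0 < w := by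
  rcases Nat.eq_zero_or_pos w with e | e
  · exact absurd (by rw [e]; simp) h
  · exact e


def pA (a : ZMod n) (w₁ w₂ : ℕ) (s : ZMod n) (h d : ℕ) : Rc n × Rc n :=
  (⟨a, w₁, s, h⟩, ⟨a + w₁, w₂, s, h + d⟩)
def qA (a : ZMod n) (w₁ w₂ : ℕ) (s : ZMod n) (h d : ℕ) : Rc n × Rc n :=
  (⟨a + w₁, w₂, s + h, d⟩, ⟨a, w₁ + w₂, s, h⟩)

lemma tr_pA (x : GridState n) (a : ZMod n) (w₁ w₂ : ℕ) (s : ZMod n) (h d : ℕ)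
    (hC : CP x (pA a w₁ w₂ s h d)) (hN : NB (pA a w₁ w₂ s h d)) : Tr x (pA a w₁ w₂ s h d) (qA a w₁ w₂ s h d) := by
  have hCN : (CP x (qA a w₁ w₂ s h d) ∧ NB (qA a w₁ w₂ s h d)) ∧ (w₁ : ZMod n) ≠ 0 ∧ (w₂ : ZMod n) ≠ 0 ∧
      (h : ZMod n) ≠ 0 ∧ (d : ZMod n) ≠ 0 ∧ (w₁ + w₂ : ZMod n) ≠ 0 := by
    have hx := x.injective
    have i1 := @hx a (a + w₁)
    have i2 := @hx (a + w₁) (a + w₁ + w₂)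
    have i3 := @hx a (a + w₁ + w₂)
    clear hx
    revert hC hN i1 i2 i3
    simp only [CP, NB, pA, qA, IsR, tgt, Equiv.trans_apply, Equiv.swap_apply_def]
    push_cast
    simp only [← add_assoc]
    generalize (w₁ : ZMod n) = W₁'
    generalize (w₂ : ZMod n) = W₂'
    generalize (h : ZMod n) = H'
    generalize (d : ZMod n) = D'
    grind
  obtain ⟨⟨hC', hN'⟩, h1, h2, h3, h4, h5⟩ := hCN
  refine ⟨hC', hN', ⟨?_, ?_⟩, ?_⟩
  · clear hC hN hC' hN'
    revert h1 h2 h5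
    simp only [pA, qA, tgt]
    push_cast
    generalize (w₁ : ZMod n) = W₁
    generalize (w₂ : ZMod n) = W₂
    intro h1 h2 h5
    ext k
    simp only [Equiv.trans_apply, Equiv.swap_apply_def]
    congr 1
    grind
  · intro i k
    simp only [pA, qA, Rc.dom, kap_add]
    ring
  · have p1 := cast_pos_of_ne h1
    have p2 := cast_pos_of_ne h2
    have p3 := cast_pos_of_ne h3
    have p4 := cast_pos_of_ne h4
    clear hC hN hC' hN' h3 h4
    revert h1 h2 h5
    simp only [gi, pA, qA]
    push_cast
    intro h1 h2 h5
    grind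

lemma tr_qA (x : GridState n) (a : ZMod n) (w₁ w₂ : ℕ) (s : ZMod n) (h d : ℕ)
    (hC : CP x (qA a w₁ w₂ s h d)) (hN : NB (qA a w₁ w₂ s h d)) : Tr x (qA a w₁ w₂ s h d) (pA a w₁ w₂ s h d) := by
  have hCN : (CP x (pA a w₁ w₂ s h d) ∧ NB (pA a w₁ w₂ s h d)) ∧ (w₁ : ZMod n) ≠ 0 ∧ (w₂ : ZMod n) ≠ 0 ∧
      (h : ZMod n) ≠ 0 ∧ (d : ZMod n) ≠ 0 ∧ (w₁ + w₂ : ZMod n) ≠ 0 := by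
    have hx := x.injective
    have i1 := @hx a (a + w₁)
    have i2 := @hx (a + w₁) (a + w₁ + w₂)
    have i3 := @hx a (a + w₁ + w₂)
    clear hx
    revert hC hN i1 i2 i3
    simp only [CP, NB, pA, qA, IsR, tgt, Equiv.trans_apply, Equiv.swap_apply_def]
    push_cast
    simp only [← add_assoc]
    generalize (w₁ : ZMod n) = W₁'
    generalize (w₂ : ZMod n) = W₂'
    generalize (h : ZMod n) = H'
    generalize (d : ZMod n) = D'
    grind
  obtain ⟨⟨hC', hN'⟩, h1, h2, h3, h4, h5⟩ := hCN
  refine ⟨hC', hN', ⟨?_, ?_⟩, ?_⟩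
  · clear hC hN hC' hN'
    revert h1 h2 h5
    simp only [pA, qA, tgt]
    push_cast
    generalize (w₁ : ZMod n) = W₁
    generalize (w₂ : ZMod n) = W₂
    intro h1 h2 h5
    ext k
    simp only [Equiv.trans_apply, Equiv.swap_apply_def]
    congr 1
    grind
  · intro i k
    simp only [pA, qA, Rc.dom, kap_add]
    ring
  · have p1 := cast_pos_of_ne h1
    have p2 := cast_pos_of_ne h2
    have p3 := cast_pos_of_ne h3
    have p4 := cast_pos_of_ne h4
    clear hC hN hC' hN' h3 h4
    revert h1 h2 h5
    simp only [gi, pA, qA]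
    push_cast
    intro h1 h2 h5
    grind

def pB (a : ZMod n) (w₁ w₂ : ℕ) (s : ZMod n) (h d : ℕ) : Rc n × Rc n :=
  (⟨a, w₁, s, h + d⟩, ⟨a + w₁, w₂, s, h⟩)
def qB (a : ZMod n) (w₁ w₂ : ℕ) (s : ZMod n) (h d : ℕ) : Rc n × Rc n :=
  (⟨a, w₁ + w₂, s, h⟩, ⟨a, w₁, s + h, d⟩)

lemma tr_pB (x : GridState n) (a : ZMod n) (w₁ w₂ : ℕ) (s : ZMod n) (h d : ℕ)
    (hC : CP x (pB a w₁ w₂ s h d)) (hN : NB (pB a w₁ w₂ s h d)) : Tr x (pB a w₁ w₂ s h d) (qB a w₁ w₂ s h d) := by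
  have hCN : (CP x (qB a w₁ w₂ s h d) ∧ NB (qB a w₁ w₂ s h d)) ∧ (w₁ : ZMod n) ≠ 0 ∧ (w₂ : ZMod n) ≠ 0 ∧
      (h : ZMod n) ≠ 0 ∧ (d : ZMod n) ≠ 0 ∧ (w₁ + w₂ : ZMod n) ≠ 0 := by
    have hx := x.injective
    have i1 := @hx a (a + w₁)
    have i2 := @hx (a + w₁) (a + w₁ + w₂)
    have i3 := @hx a (a + w₁ + w₂)
    clear hx
    revert hC hN i1 i2 i3
    simp only [CP, NB, pB, qB, IsR, tgt, Equiv.trans_apply, Equiv.swap_apply_def]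
    push_cast
    simp only [← add_assoc]
    generalize (w₁ : ZMod n) = W₁'
    generalize (w₂ : ZMod n) = W₂'
    generalize (h : ZMod n) = H'
    generalize (d : ZMod n) = D'
    grind
  obtain ⟨⟨hC', hN'⟩, h1, h2, h3, h4, h5⟩ := hCN
  refine ⟨hC', hN', ⟨?_, ?_⟩, ?_⟩
  · clear hC hN hC' hN'
    revert h1 h2 h5
    simp only [pB, qB, tgt]
    push_cast
    generalize (w₁ : ZMod n) = W₁
    generalize (w₂ : ZMod n) = W₂
    intro h1 h2 h5
    ext k
    simp only [Equiv.trans_apply, Equiv.swap_apply_def]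
    congr 1
    grind
  · intro i k
    simp only [pB, qB, Rc.dom, kap_add]
    ring
  · have p1 := cast_pos_of_ne h1
    have p2 := cast_pos_of_ne h2
    have p3 := cast_pos_of_ne h3
    have p4 := cast_pos_of_ne h4
    clear hC hN hC' hN' h3 h4
    revert h1 h2 h5
    simp only [gi, pB, qB]
    push_cast
    intro h1 h2 h5
    grind

lemma tr_qB (x : GridState n) (a : ZMod n) (w₁ w₂ : ℕ) (s : ZMod n) (h d : ℕ)
    (hC : CP x (qB a w₁ w₂ s h d)) (hN : NB (qB a w₁ w₂ s h d)) : Tr x (qB a w₁ w₂ s h d) (pB a w₁ w₂ s h d) := by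
  have hCN : (CP x (pB a w₁ w₂ s h d) ∧ NB (pB a w₁ w₂ s h d)) ∧ (w₁ : ZMod n) ≠ 0 ∧ (w₂ : ZMod n) ≠ 0 ∧
      (h : ZMod n) ≠ 0 ∧ (d : ZMod n) ≠ 0 ∧ (w₁ + w₂ : ZMod n) ≠ 0 := by
    have hx := x.injective
    have i1 := @hx a (a + w₁)
    have i2 := @hx (a + w₁) (a + w₁ + w₂)
    have i3 := @hx a (a + w₁ + w₂)
    clear hx
    revert hC hN i1 i2 i3
    simp only [CP, NB, pB, qB, IsR, tgt, Equiv.trans_apply, Equiv.swap_apply_def]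
    push_cast
    simp only [← add_assoc]
    generalize (w₁ : ZMod n) = W₁'
    generalize (w₂ : ZMod n) = W₂'
    generalize (h : ZMod n) = H'
    generalize (d : ZMod n) = D'
    grind
  obtain ⟨⟨hC', hN'⟩, h1, h2, h3, h4, h5⟩ := hCN
  refine ⟨hC', hN', ⟨?_, ?_⟩, ?_⟩
  · clear hC hN hC' hN'
    revert h1 h2 h5
    simp only [pB, qB, tgt]
    push_cast
    generalize (w₁ : ZMod n) = W₁
    generalize (w₂ : ZMod n) = W₂
    intro h1 h2 h5
    ext k
    simp only [Equiv.trans_apply, Equiv.swap_apply_def]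
    congr 1
    grind
  · intro i k
    simp only [pB, qB, Rc.dom, kap_add]
    ring
  · have p1 := cast_pos_of_ne h1
    have p2 := cast_pos_of_ne h2
    have p3 := cast_pos_of_ne h3
    have p4 := cast_pos_of_ne h4
    clear hC hN hC' hN' h3 h4
    revert h1 h2 h5
    simp only [gi, pB, qB]
    push_cast
    intro h1 h2 h5
    grind

def pC (a : ZMod n) (w₁ w₂ : ℕ) (s : ZMod n) (h d : ℕ) : Rc n × Rc n :=
  (⟨a, w₁ + w₂, s + h, d⟩, ⟨a + w₁, w₂, s, h⟩)
def qC (a : ZMod n) (w₁ w₂ : ℕ) (s : ZMod n) (h d : ℕ) : Rc n × Rc n :=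
  (⟨a + w₁, w₂, s, h + d⟩, ⟨a, w₁, s + h, d⟩)

lemma tr_pC (x : GridState n) (a : ZMod n) (w₁ w₂ : ℕ) (s : ZMod n) (h d : ℕ)
    (hC : CP x (pC a w₁ w₂ s h d)) (hN : NB (pC a w₁ w₂ s h d)) : Tr x (pC a w₁ w₂ s h d) (qC a w₁ w₂ s h d) := by
  have hCN : (CP x (qC a w₁ w₂ s h d) ∧ NB (qC a w₁ w₂ s h d)) ∧ (w₁ : ZMod n) ≠ 0 ∧ (w₂ : ZMod n) ≠ 0 ∧
      (h : ZMod n) ≠ 0 ∧ (d : ZMod n) ≠ 0 ∧ (w₁ + w₂ : ZMod n) ≠ 0 := by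
    have hx := x.injective
    have i1 := @hx a (a + w₁)
    have i2 := @hx (a + w₁) (a + w₁ + w₂)
    have i3 := @hx a (a + w₁ + w₂)
    clear hx
    revert hC hN i1 i2 i3
    simp only [CP, NB, pC, qC, IsR, tgt, Equiv.trans_apply, Equiv.swap_apply_def]
    push_cast
    simp only [← add_assoc]
    generalize (w₁ : ZMod n) = W₁'
    generalize (w₂ : ZMod n) = W₂'
    generalize (h : ZMod n) = H'
    generalize (d : ZMod n) = D'
    grind
  obtain ⟨⟨hC', hN'⟩, h1, h2, h3, h4, h5⟩ := hCN
  refine ⟨hC', hN', ⟨?_, ?_⟩, ?_⟩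
  · clear hC hN hC' hN'
    revert h1 h2 h5
    simp only [pC, qC, tgt]
    push_cast
    generalize (w₁ : ZMod n) = W₁
    generalize (w₂ : ZMod n) = W₂
    intro h1 h2 h5
    ext k
    simp only [Equiv.trans_apply, Equiv.swap_apply_def]
    congr 1
    grind
  · intro i k
    simp only [pC, qC, Rc.dom, kap_add]
    ring
  · have p1 := cast_pos_of_ne h1
    have p2 := cast_pos_of_ne h2
    have p3 := cast_pos_of_ne h3
    have p4 := cast_pos_of_ne h4
    clear hC hN hC' hN' h3 h4
    revert h1 h2 h5
    simp only [gi, pC, qC]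
    push_cast
    intro h1 h2 h5
    grind

lemma tr_qC (x : GridState n) (a : ZMod n) (w₁ w₂ : ℕ) (s : ZMod n) (h d : ℕ)
    (hC : CP x (qC a w₁ w₂ s h d)) (hN : NB (qC a w₁ w₂ s h d)) : Tr x (qC a w₁ w₂ s h d) (pC a w₁ w₂ s h d) := by
  have hCN : (CP x (pC a w₁ w₂ s h d) ∧ NB (pC a w₁ w₂ s h d)) ∧ (w₁ : ZMod n) ≠ 0 ∧ (w₂ : ZMod n) ≠ 0 ∧
      (h : ZMod n) ≠ 0 ∧ (d : ZMod n) ≠ 0 ∧ (w₁ + w₂ : ZMod n) ≠ 0 := by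
    have hx := x.injective
    have i1 := @hx a (a + w₁)
    have i2 := @hx (a + w₁) (a + w₁ + w₂)
    have i3 := @hx a (a + w₁ + w₂)
    clear hx
    revert hC hN i1 i2 i3
    simp only [CP, NB, pC, qC, IsR, tgt, Equiv.trans_apply, Equiv.swap_apply_def]
    push_cast
    simp only [← add_assoc]
    generalize (w₁ : ZMod n) = W₁'
    generalize (w₂ : ZMod n) = W₂'
    generalize (h : ZMod n) = H'
    generalize (d : ZMod n) = D'
    grind
  obtain ⟨⟨hC', hN'⟩, h1, h2, h3, h4, h5⟩ := hCN
  refine ⟨hC', hN', ⟨?_, ?_⟩, ?_⟩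
  · clear hC hN hC' hN'
    revert h1 h2 h5
    simp only [pC, qC, tgt]
    push_cast
    generalize (w₁ : ZMod n) = W₁
    generalize (w₂ : ZMod n) = W₂
    intro h1 h2 h5
    ext k
    simp only [Equiv.trans_apply, Equiv.swap_apply_def]
    congr 1
    grind
  · intro i k
    simp only [pC, qC, Rc.dom, kap_add]
    ring
  · have p1 := cast_pos_of_ne h1
    have p2 := cast_pos_of_ne h2
    have p3 := cast_pos_of_ne h3
    have p4 := cast_pos_of_ne h4
    clear hC hN hC' hN' h3 h4
    revert h1 h2 h5
    simp only [gi, pC, qC]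
    push_cast
    intro h1 h2 h5
    grind

def pD (a : ZMod n) (w₁ w₂ : ℕ) (s : ZMod n) (h d : ℕ) : Rc n × Rc n :=
  (⟨a, w₁, s, h⟩, ⟨a, w₁ + w₂, s + h, d⟩)
def qD (a : ZMod n) (w₁ w₂ : ℕ) (s : ZMod n) (h d : ℕ) : Rc n × Rc n :=
  (⟨a + w₁, w₂, s + h, d⟩, ⟨a, w₁, s, h + d⟩)

lemma tr_pD (x : GridState n) (a : ZMod n) (w₁ w₂ : ℕ) (s : ZMod n) (h d : ℕ)
    (hC : CP x (pD a w₁ w₂ s h d)) (hN : NB (pD a w₁ w₂ s h d)) : Tr x (pD a w₁ w₂ s h d) (qD a w₁ w₂ s h d) := by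
  have hCN : (CP x (qD a w₁ w₂ s h d) ∧ NB (qD a w₁ w₂ s h d)) ∧ (w₁ : ZMod n) ≠ 0 ∧ (w₂ : ZMod n) ≠ 0 ∧
      (h : ZMod n) ≠ 0 ∧ (d : ZMod n) ≠ 0 ∧ (w₁ + w₂ : ZMod n) ≠ 0 := by
    have hx := x.injective
    have i1 := @hx a (a + w₁)
    have i2 := @hx (a + w₁) (a + w₁ + w₂)
    have i3 := @hx a (a + w₁ + w₂)
    clear hx
    revert hC hN i1 i2 i3
    simp only [CP, NB, pD, qD, IsR, tgt, Equiv.trans_apply, Equiv.swap_apply_def]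
    push_cast
    simp only [← add_assoc]
    generalize (w₁ : ZMod n) = W₁'
    generalize (w₂ : ZMod n) = W₂'
    generalize (h : ZMod n) = H'
    generalize (d : ZMod n) = D'
    grind
  obtain ⟨⟨hC', hN'⟩, h1, h2, h3, h4, h5⟩ := hCN
  refine ⟨hC', hN', ⟨?_, ?_⟩, ?_⟩
  · clear hC hN hC' hN'
    revert h1 h2 h5
    simp only [pD, qD, tgt]
    push_cast
    generalize (w₁ : ZMod n) = W₁
    generalize (w₂ : ZMod n) = W₂
    intro h1 h2 h5
    ext k
    simp only [Equiv.trans_apply, Equiv.swap_apply_def]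
    congr 1
    grind
  · intro i k
    simp only [pD, qD, Rc.dom, kap_add]
    ring
  · have p1 := cast_pos_of_ne h1
    have p2 := cast_pos_of_ne h2
    have p3 := cast_pos_of_ne h3
    have p4 := cast_pos_of_ne h4
    clear hC hN hC' hN' h3 h4
    revert h1 h2 h5
    simp only [gi, pD, qD]
    push_cast
    intro h1 h2 h5
    grind

lemma tr_qD (x : GridState n) (a : ZMod n) (w₁ w₂ : ℕ) (s : ZMod n) (h d : ℕ)
    (hC : CP x (qD a w₁ w₂ s h d)) (hN : NB (qD a w₁ w₂ s h d)) : Tr x (qD a w₁ w₂ s h d) (pD a w₁ w₂ s h d) := by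
  have hCN : (CP x (pD a w₁ w₂ s h d) ∧ NB (pD a w₁ w₂ s h d)) ∧ (w₁ : ZMod n) ≠ 0 ∧ (w₂ : ZMod n) ≠ 0 ∧
      (h : ZMod n) ≠ 0 ∧ (d : ZMod n) ≠ 0 ∧ (w₁ + w₂ : ZMod n) ≠ 0 := by
    have hx := x.injective
    have i1 := @hx a (a + w₁)
    have i2 := @hx (a + w₁) (a + w₁ + w₂)
    have i3 := @hx a (a + w₁ + w₂)
    clear hx
    revert hC hN i1 i2 i3
    simp only [CP, NB, pD, qD, IsR, tgt, Equiv.trans_apply, Equiv.swap_apply_def]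
    push_cast
    simp only [← add_assoc]
    generalize (w₁ : ZMod n) = W₁'
    generalize (w₂ : ZMod n) = W₂'
    generalize (h : ZMod n) = H'
    generalize (d : ZMod n) = D'
    grind
  obtain ⟨⟨hC', hN'⟩, h1, h2, h3, h4, h5⟩ := hCN
  refine ⟨hC', hN', ⟨?_, ?_⟩, ?_⟩
  · clear hC hN hC' hN'
    revert h1 h2 h5
    simp only [pD, qD, tgt]
    push_cast
    generalize (w₁ : ZMod n) = W₁
    generalize (w₂ : ZMod n) = W₂
    intro h1 h2 h5
    ext k
    simp only [Equiv.trans_apply, Equiv.swap_apply_def]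
    congr 1
    grind
  · intro i k
    simp only [pD, qD, Rc.dom, kap_add]
    ring
  · have p1 := cast_pos_of_ne h1
    have p2 := cast_pos_of_ne h2
    have p3 := cast_pos_of_ne h3
    have p4 := cast_pos_of_ne h4
    clear hC hN hC' hN' h3 h4
    revert h1 h2 h5
    simp only [gi, pD, qD]
    push_cast
    intro h1 h2 h5
    grind

lemma tr_swap (x : GridState n) (r₁ r₂ : Rc n) (hC : CP x (r₁, r₂))
    (e1 : r₁.a + r₁.w ≠ r₂.a) (e2 : r₁.a + r₁.w ≠ r₂.a + r₂.w) (e3 : r₁.a ≠ r₂.a)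
    (e4 : r₁.a ≠ r₂.a + r₂.w) : Tr x (r₁, r₂) (r₂, r₁) := by
  refine ⟨?_, ?_, ⟨?_, ?_⟩, ?_⟩
  · revert hC
    simp only [CP, IsR, tgt, Equiv.trans_apply, Equiv.swap_apply_def]
    grind
  · simp only [NB]
    grind
  · simp only [tgt]
    ext k
    simp only [Equiv.trans_apply, Equiv.swap_apply_def]
    congr 1
    grind
  · intro i k
    simp only []
    ring
  · simp [gi, e1, e2, e3, e4]

lemma tr_all (x : GridState n) (p : Rc n × Rc n) (hC : CP x p) (hN : NB p) :
    Tr x p (gi p) ∧ gi (gi p) = p ∧ gi p ≠ p := by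
  have key : ∃ q, Tr x p q ∧ Tr x q p ∧ q ≠ p := by
    obtain ⟨⟨a₁, w₁, s₁, h₁⟩, ⟨a₂, w₂, s₂, h₂⟩⟩ := p
    have hC0 := hC
    obtain ⟨c1, c2⟩ := hC
    have d1 := c1.1
    have d2 := c1.2.1
    have d3 := c1.2.2
    have d4 := c2.1
    have d5 := c2.2.1
    have d6 := c2.2.2
    have n1 := hN.1
    have n2 := hN.2
    have t1 := tgt_a c1
    have t2 := tgt_b c1
    simp only at d1 d2 d3 d4 d5 d6 n1 n2 t1 t2
    have pos1 := c1.w_pos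
    have pos2 := c2.w_pos
    have pos3 := c1.h_pos
    have pos4 := c2.h_pos
    simp only at pos1 pos2 pos3 pos4
    by_cases E1 : a₁ + (w₁ : ZMod n) = a₂
    · have es : s₂ = s₁ := by rw [← d4, ← E1, t2]
      rcases lt_trichotomy h₁ h₂ with hl | hl | hl
      · have ep : ((⟨a₁, w₁, s₁, h₁⟩, ⟨a₂, w₂, s₂, h₂⟩) : Rc n × Rc n) = pA a₁ w₁ w₂ s₁ h₁ (h₂ - h₁) := by
          unfold pA
          refine Prod.ext (Rc.ext ?_ ?_ ?_ ?_) (Rc.ext ?_ ?_ ?_ ?_) <;> dsimp only <;>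
            first | done | rfl | omega | (push_cast [Nat.cast_sub (le_of_lt hl)]; done) |
              (push_cast [Nat.cast_sub (le_of_lt hl)]; grind)
        rw [ep] at hC0 hN ⊢
        have T := tr_pA x _ _ _ _ _ _ hC0 hN
        have T' := tr_qA x _ _ _ _ _ _ T.1 T.2.1
        refine ⟨_, T, T', ?_⟩
        intro e
        have e' := congrArg (fun p => (p.1.a, p.1.w, p.1.h, p.2.a, p.2.w, p.2.h)) e
        simp only [pA, qA, Prod.mk.injEq] at e'
        grind
      · exfalso
        subst E1 es hl
        have : tgt x ⟨a₁, w₁, s₂, h₁⟩ (a₁ + w₁ + w₂) = tgt x ⟨a₁, w₁, s₂, h₁⟩ a₁ := by rw [d5, t1]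
        have := (tgt x _).injective this
        exact n1 ⟨rfl, this.symm⟩
      · have ep : ((⟨a₁, w₁, s₁, h₁⟩, ⟨a₂, w₂, s₂, h₂⟩) : Rc n × Rc n) = pB a₁ w₁ w₂ s₁ h₂ (h₁ - h₂) := by
          unfold pB
          refine Prod.ext (Rc.ext ?_ ?_ ?_ ?_) (Rc.ext ?_ ?_ ?_ ?_) <;> dsimp only <;>
            first | done | rfl | omega | (push_cast [Nat.cast_sub (le_of_lt hl)]; done) |
              (push_cast [Nat.cast_sub (le_of_lt hl)]; grind)
        rw [ep] at hC0 hN ⊢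
        have T := tr_pB x _ _ _ _ _ _ hC0 hN
        have T' := tr_qB x _ _ _ _ _ _ T.1 T.2.1
        refine ⟨_, T, T', ?_⟩
        intro e
        have e' := congrArg (fun p => (p.1.a, p.1.w, p.1.h, p.2.a, p.2.w, p.2.h)) e
        simp only [pB, qB, Prod.mk.injEq] at e'
        grind
    by_cases E2 : a₁ + (w₁ : ZMod n) = a₂ + w₂
    · have es : s₁ = s₂ + h₂ := by rw [← d5, ← E2, t2]
      rcases lt_trichotomy w₁ w₂ with hl | hl | hl
      · have ep : ((⟨a₁, w₁, s₁, h₁⟩, ⟨a₂, w₂, s₂, h₂⟩) : Rc n × Rc n) = qA a₂ (w₂ - w₁) w₁ s₂ h₂ h₁ := by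
          unfold qA
          refine Prod.ext (Rc.ext ?_ ?_ ?_ ?_) (Rc.ext ?_ ?_ ?_ ?_) <;> dsimp only <;>
            first | done | rfl | omega | (push_cast [Nat.cast_sub (le_of_lt hl)]; done) |
              (push_cast [Nat.cast_sub (le_of_lt hl)]; grind)
        rw [ep] at hC0 hN ⊢
        have T := tr_qA x _ _ _ _ _ _ hC0 hN
        have T' := tr_pA x _ _ _ _ _ _ T.1 T.2.1
        refine ⟨_, T, T', ?_⟩
        intro e
        have e' := congrArg (fun p => (p.1.a, p.1.w, p.1.h, p.2.a, p.2.w, p.2.h)) e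
        simp only [pA, qA, Prod.mk.injEq] at e'
        grind
      · exfalso
        subst hl
        have : a₁ = a₂ := by simpa using E2
        exact n2 ⟨this, E2⟩
      · have ep : ((⟨a₁, w₁, s₁, h₁⟩, ⟨a₂, w₂, s₂, h₂⟩) : Rc n × Rc n) = pC a₁ (w₁ - w₂) w₂ s₂ h₂ h₁ := by
          unfold pC
          refine Prod.ext (Rc.ext ?_ ?_ ?_ ?_) (Rc.ext ?_ ?_ ?_ ?_) <;> dsimp only <;>
            first | done | rfl | omega | (push_cast [Nat.cast_sub (le_of_lt hl)]; done) |
              (push_cast [Nat.cast_sub (le_of_lt hl)]; grind)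
        rw [ep] at hC0 hN ⊢
        have T := tr_pC x _ _ _ _ _ _ hC0 hN
        have T' := tr_qC x _ _ _ _ _ _ T.1 T.2.1
        refine ⟨_, T, T', ?_⟩
        intro e
        have e' := congrArg (fun p => (p.1.a, p.1.w, p.1.h, p.2.a, p.2.w, p.2.h)) e
        simp only [pC, qC, Prod.mk.injEq] at e'
        grind
    by_cases E3 : a₁ = a₂
    · have es : s₂ = s₁ + h₁ := by rw [← d4, ← E3, t1]
      rcases lt_trichotomy w₁ w₂ with hl | hl | hl
      · have ep : ((⟨a₁, w₁, s₁, h₁⟩, ⟨a₂, w₂, s₂, h₂⟩) : Rc n × Rc n) = pD a₁ w₁ (w₂ - w₁) s₁ h₁ h₂ := by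
          unfold pD
          refine Prod.ext (Rc.ext ?_ ?_ ?_ ?_) (Rc.ext ?_ ?_ ?_ ?_) <;> dsimp only <;>
            first | done | rfl | omega | (push_cast [Nat.cast_sub (le_of_lt hl)]; done) |
              (push_cast [Nat.cast_sub (le_of_lt hl)]; grind)
        rw [ep] at hC0 hN ⊢
        have T := tr_pD x _ _ _ _ _ _ hC0 hN
        have T' := tr_qD x _ _ _ _ _ _ T.1 T.2.1
        refine ⟨_, T, T', ?_⟩
        intro e
        have e' := congrArg (fun p => (p.1.a, p.1.w, p.1.h, p.2.a, p.2.w, p.2.h)) e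
        simp only [pD, qD, Prod.mk.injEq] at e'
        grind
      · exfalso
        subst hl
        exact E2 (by rw [E3])
      · have ep : ((⟨a₁, w₁, s₁, h₁⟩, ⟨a₂, w₂, s₂, h₂⟩) : Rc n × Rc n) = qB a₁ w₂ (w₁ - w₂) s₁ h₁ h₂ := by
          unfold qB
          refine Prod.ext (Rc.ext ?_ ?_ ?_ ?_) (Rc.ext ?_ ?_ ?_ ?_) <;> dsimp only <;>
            first | done | rfl | omega | (push_cast [Nat.cast_sub (le_of_lt hl)]; done) |
              (push_cast [Nat.cast_sub (le_of_lt hl)]; grind)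
        rw [ep] at hC0 hN ⊢
        have T := tr_qB x _ _ _ _ _ _ hC0 hN
        have T' := tr_pB x _ _ _ _ _ _ T.1 T.2.1
        refine ⟨_, T, T', ?_⟩
        intro e
        have e' := congrArg (fun p => (p.1.a, p.1.w, p.1.h, p.2.a, p.2.w, p.2.h)) e
        simp only [pB, qB, Prod.mk.injEq] at e'
        grind
    by_cases E4 : a₁ = a₂ + w₂
    · have es : s₂ + h₂ = s₁ + h₁ := by rw [← d5, ← E4, t1]
      rcases lt_trichotomy h₁ h₂ with hl | hl | hl
      · have ep : ((⟨a₁, w₁, s₁, h₁⟩, ⟨a₂, w₂, s₂, h₂⟩) : Rc n × Rc n) = qD a₂ w₂ w₁ s₂ (h₂ - h₁) h₁ := by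
          unfold qD
          refine Prod.ext (Rc.ext ?_ ?_ ?_ ?_) (Rc.ext ?_ ?_ ?_ ?_) <;> dsimp only <;>
            first | done | rfl | omega | (push_cast [Nat.cast_sub (le_of_lt hl)]; done) |
              (push_cast [Nat.cast_sub (le_of_lt hl)]; grind)
        rw [ep] at hC0 hN ⊢
        have T := tr_qD x _ _ _ _ _ _ hC0 hN
        have T' := tr_pD x _ _ _ _ _ _ T.1 T.2.1
        refine ⟨_, T, T', ?_⟩
        intro e
        have e' := congrArg (fun p => (p.1.a, p.1.w, p.1.h, p.2.a, p.2.w, p.2.h)) e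
        simp only [pD, qD, Prod.mk.injEq] at e'
        grind
      · exfalso
        subst hl
        have es' : s₂ = s₁ := by simpa using es
        have : tgt x ⟨a₁, w₁, s₁, h₁⟩ a₂ = tgt x ⟨a₁, w₁, s₁, h₁⟩ (a₁ + w₁) := by rw [d4, t2, es']
        exact E1 ((tgt x _).injective this).symm
      · have ep : ((⟨a₁, w₁, s₁, h₁⟩, ⟨a₂, w₂, s₂, h₂⟩) : Rc n × Rc n) = qC a₂ w₂ w₁ s₁ (h₁ - h₂) h₂ := by
          unfold qC
          refine Prod.ext (Rc.ext ?_ ?_ ?_ ?_) (Rc.ext ?_ ?_ ?_ ?_) <;> dsimp only <;>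
            first | done | rfl | omega | (push_cast [Nat.cast_sub (le_of_lt hl)]; done) |
              (push_cast [Nat.cast_sub (le_of_lt hl)]; grind)
        rw [ep] at hC0 hN ⊢
        have T := tr_qC x _ _ _ _ _ _ hC0 hN
        have T' := tr_pC x _ _ _ _ _ _ T.1 T.2.1
        refine ⟨_, T, T', ?_⟩
        intro e
        have e' := congrArg (fun p => (p.1.a, p.1.w, p.1.h, p.2.a, p.2.w, p.2.h)) e
        simp only [pC, qC, Prod.mk.injEq] at e'
        grind
    refine ⟨_, tr_swap x _ _ hC0 E1 E2 E3 E4, tr_swap x _ _ (tr_swap x _ _ hC0 E1 E2 E3 E4).1 ?_ ?_ ?_ ?_, ?_⟩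
    · exact fun e => E4 e.symm
    · exact fun e => E2 e.symm
    · exact fun e => E3 e.symm
    · exact fun e => E1 e.symm
    · intro e
      have e' := congrArg (fun p => p.2.a) e
      exact E3 e'
  obtain ⟨q, h1, h2, h3⟩ := key
  have e1 := h1.2.2.2
  have e2 := h2.2.2.2
  rw [e1, e2]
  exact ⟨h1, rfl, h3⟩

end

section
set_option linter.unusedSectionVars false
open Finset
variable {n : ℕ} [NeZero n]

/-- weight of a rectangle -/
def wtc (G : GridDiagram n) (x : GridState n) (r : Rc n) : Rng n :=
  (∏ i : ZMod n, Vv i ^ r.dom i (G.Orow i)) * vV ^ mc x r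

lemma wtc_mul (G : GridDiagram n) (x y : GridState n) (r₁ r₂ : Rc n) :
    wtc G x r₁ * wtc G y r₂ =
      (∏ i : ZMod n, Vv i ^ (r₁.dom i (G.Orow i) + r₂.dom i (G.Orow i))) *
        vV ^ (mc x r₁ + mc y r₂) := by
  unfold wtc
  simp only [pow_add, Finset.prod_mul_distrib]
  ring

/-- contribution of a pair -/
def fP (G : GridDiagram n) (x : GridState n) (p : Rc n × Rc n) : GC n :=
  Finsupp.single (tgt (tgt x p.1) p.2) (wtc G x p.1 * wtc G (tgt x p.1) p.2)

lemma fP_eq (G : GridDiagram n) (x : GridState n) (p q : Rc n × Rc n) (hp : CP x p) (hq : CP x q)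
    (h : PE x p q) : fP G x p = fP G x q := by
  unfold fP
  have hm : mc x p.1 + mc (tgt x p.1) p.2 = mc x q.1 + mc (tgt x q.1) q.2 := by
    have h1 := mc_add hp.1 hp.2
    have h2 := mc_add hq.1 hq.2
    have hD : (fun i k => p.1.dom i k + p.2.dom i k) = (fun i k => q.1.dom i k + q.2.dom i k) := by
      funext i k; exact h.2 i k
    rw [← hD, ← h.1, ← h1] at h2
    have : ((mc x p.1 + mc (tgt x p.1) p.2 : ℕ) : ℚ) = ((mc x q.1 + mc (tgt x q.1) q.2 : ℕ) : ℚ) := by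
      linarith
    exact_mod_cast this
  rw [h.1, wtc_mul, wtc_mul, hm]
  simp only [h.2]

lemma sum_comp_bij (f : ZMod n → ZMod n) (hf : Function.Bijective f) {M : Type*} [AddCommMonoid M]
    (g : ZMod n → M) :
    ∑ i, g (f i) = ∑ i, g i := by
  exact Function.Bijective.sum_comp hf g

lemma size_RS (X : ZMod n → ZMod n) (hX : Function.Bijective X) (r : Rc n) (hw : 0 < r.w)
    (hh : 0 < r.h) (hs : ∑ i, r.dom i (X i) ≤ 1) : r ∈ RS n := by
  rw [mem_RS]
  constructor
  · by_contra hc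
    push Not at hc
    have h1 : ∑ i, 2 * kap r.s r.h (X i) ≤ ∑ i, r.dom i (X i) :=
      Finset.sum_le_sum fun i _ => Nat.mul_le_mul_right _ (kap_ge_two r.a hc i)
    rw [← Finset.mul_sum, sum_comp_bij X hX (fun k => kap r.s r.h k), sum_kap] at h1
    omega
  · by_contra hc
    push Not at hc
    have h1 : ∑ i, kap r.a r.w i * 2 ≤ ∑ i, r.dom i (X i) :=
      Finset.sum_le_sum fun i _ => Nat.mul_le_mul_left _ (kap_ge_two r.s hc (X i))
    rw [← Finset.sum_mul, sum_kap] at h1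
    omega

lemma kap_self (a : ZMod n) {w : ℕ} (h : 0 < w) : 1 ≤ kap a w a := by
  have := kap_mono a (show 1 ≤ w from h) a
  rw [kap_one] at this
  simpa using this

lemma kap_end (s : ZMod n) {h : ℕ} (hh : h < n) : kap s h (s + h) = 0 := by
  unfold kap
  apply Finset.sum_eq_zero
  intro j hj
  rw [Finset.mem_range] at hj
  rw [if_neg]
  intro e
  have e' : (j : ZMod n) = (h : ZMod n) := add_left_cancel e
  have := (ZMod.natCast_eq_natCast_iff' j h n).1 e'
  rw [Nat.mod_eq_of_lt (by omega), Nat.mod_eq_of_lt hh] at this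
  omega

lemma kap_at (a : ZMod n) {w j : ℕ} (h : j < w) : 1 ≤ kap a w (a + j) := by
  have := kap_mono a (show j + 1 ≤ w from h) (a + j)
  rw [kap_succ, if_pos rfl] at this
  omega

lemma core (hn : 2 ≤ n) (X : ZMod n → ZMod n) (hX : Function.Bijective X) (a j s : ZMod n)
    (w₁ w₂ h₁ h₂ : ℕ) (pw1 : 0 < w₁) (pw2 : 0 < w₂) (ph1 : 0 < h₁) (ph2 : 0 < h₂)
    (hw : (w₁ : ZMod n) = w₂) (hh : ((h₁ + h₂ : ℕ) : ZMod n) = 0)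
    (H : ∀ i, kap a w₁ i * kap s h₁ (X i) + kap a w₂ i * kap (s + (h₁ : ZMod n)) h₂ (X i) =
      if i = j then 1 else 0) :
    w₁ = 1 ∧ w₂ = 1 ∧ a = j ∧ h₁ + h₂ = n := by
  have hdvd : n ∣ h₁ + h₂ := (ZMod.natCast_eq_zero_iff _ _).1 hh
  have hge : n ≤ h₁ + h₂ := Nat.le_of_dvd (by omega) hdvd
  have hAB : ∀ k, 1 ≤ kap s h₁ k + kap (s + (h₁ : ZMod n)) h₂ k := by
    intro k
    rw [← kap_add]; exact kap_ge_one s hge k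
  have sA : ∑ i, kap s h₁ (X i) = h₁ := by
    rw [sum_comp_bij X hX (fun k => kap s h₁ k), sum_kap]
  have sB : ∑ i, kap (s + (h₁ : ZMod n)) h₂ (X i) = h₂ := by
    rw [sum_comp_bij X hX (fun k => kap (s + (h₁ : ZMod n)) h₂ k), sum_kap]
  have k1 := kap_self a pw1
  have k2 := kap_self a pw2
  have haj : a = j := by
    by_contra hne
    have h0 := H a
    rw [if_neg hne] at h0
    have := hAB (X a)
    simp only [Nat.add_eq_zero_iff, Nat.mul_eq_zero] at h0
    omega
  subst haj
  have Ha := H a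
  rw [if_pos rfl] at Ha
  have hne1 : a + ((1 : ℕ) : ZMod n) ≠ a := by
    intro e
    have : ((1 : ℕ) : ZMod n) = 0 := by simpa using e
    have := (ZMod.natCast_eq_zero_iff _ _).1 this
    have := Nat.le_of_dvd (by omega) this
    omega
  have big : ∀ u v : ℕ, (u : ZMod n) = v → 1 < u → v = 1 → ∀ k, 2 ≤ kap a u k + if k = a then 0 else 1 := by
    intro u v huv hu hv k
    subst hv
    have := (ZMod.natCast_eq_natCast_iff' u 1 n).1 huv
    rw [Nat.mod_eq_of_lt (show 1 < n by omega)] at this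
    have hu1 : n + 1 ≤ u := by
      by_contra hc
      rcases Nat.lt_or_ge u n with h | h
      · rw [Nat.mod_eq_of_lt h] at this; omega
      · have : u = n := by omega
        subst this
        simp at this
    have h3 := kap_mono a hu1 k
    rw [add_comm n 1, kap_add, kap_one, kap_full] at h3
    split_ifs at h3 ⊢ <;> grind
  have hw1 : w₁ = 1 := by
    by_contra hc
    have hb1 := kap_at a (show 1 < w₁ by omega)
    by_cases h2 : w₂ = 1
    · have hz : ∀ i, kap s h₁ (X i) = 0 := by
        intro i
        have b := big w₁ w₂ hw (by omega) h2 i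
        have hi := H i
        split_ifs at b hi with e
        · by_contra hc
          have : 2 * 1 ≤ kap a w₁ i * kap s h₁ (X i) := Nat.mul_le_mul (by omega) (by omega)
          omega
        · have : kap a w₁ i * kap s h₁ (X i) = 0 := by omega
          rcases Nat.mul_eq_zero.1 this with h | h <;> omega
      rw [Finset.sum_eq_zero (fun i _ => hz i)] at sA
      omega
    · have hb2 := kap_at a (show 1 < w₂ by omega)
      have h0 := H (a + ((1 : ℕ) : ZMod n))
      rw [if_neg hne1] at h0
      have := hAB (X (a + ((1 : ℕ) : ZMod n)))
      simp only [Nat.add_eq_zero_iff, Nat.mul_eq_zero] at h0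
      omega
  have hw2 : w₂ = 1 := by
    by_contra hc
    have hz : ∀ i, kap (s + (h₁ : ZMod n)) h₂ (X i) = 0 := by
      intro i
      have b := big w₂ w₁ hw.symm (by omega) hw1 i
      have hi := H i
      split_ifs at b hi with e
      · by_contra hc
        have : 2 * 1 ≤ kap a w₂ i * kap (s + (h₁ : ZMod n)) h₂ (X i) := Nat.mul_le_mul (by omega) (by omega)
        omega
      · have : kap a w₂ i * kap (s + (h₁ : ZMod n)) h₂ (X i) = 0 := by omega
        rcases Nat.mul_eq_zero.1 this with h | h <;> omega
    rw [Finset.sum_eq_zero (fun i _ => hz i)] at sB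
    omega
  refine ⟨hw1, hw2, rfl, ?_⟩
  have hlt : h₁ + h₂ < 2 * n := by
    by_contra hc
    have h3 := kap_ge_two s (show 2 * n ≤ h₁ + h₂ by omega) (X a)
    rw [kap_add] at h3
    have e1 : kap s h₁ (X a) ≤ kap a w₁ a * kap s h₁ (X a) := Nat.le_mul_of_pos_left _ k1
    have e2 : kap (s + (h₁ : ZMod n)) h₂ (X a) ≤ kap a w₂ a * kap (s + (h₁ : ZMod n)) h₂ (X a) := Nat.le_mul_of_pos_left _ k2
    omega
  obtain ⟨c, hc⟩ := hdvd
  have : c = 1 := by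
    have : c < 2 := by
      by_contra h
      nlinarith
    have : c ≠ 0 := by rintro rfl; omega
    omega
  rw [hc, this, mul_one]

end

section
set_option linter.unusedSectionVars false
open Finset
variable {n : ℕ} [NeZero n]

lemma two_le (G : GridDiagram n) : 2 ≤ n := by
  have h0 := NeZero.ne n
  have h1 : n ≠ 1 := by
    rintro rfl
    exact G.hOX 0 (Subsingleton.elim _ _)
  omega

/-- total X-multiplicity of the pair is concentrated (once) at `X_j` -/
def XC (G : GridDiagram n) (j : ZMod n) (p : Rc n × Rc n) : Prop :=
  ∀ i, p.1.dom i (G.Xrow i) + p.2.dom i (G.Xrow i) = if i = j then 1 else 0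

/-- the finite set of pairs entering the commutator -/
def TS (G : GridDiagram n) (j : ZMod n) (x : GridState n) : Finset (Rc n × Rc n) :=
  (RS n ×ˢ RS n).filter fun p => CP x p ∧ XC G j p

lemma mem_TS (G : GridDiagram n) (j : ZMod n) (x : GridState n) (p : Rc n × Rc n) :
    p ∈ TS G j x ↔ CP x p ∧ XC G j p := by
  unfold TS
  simp only [Finset.mem_filter, Finset.mem_product, and_iff_right_iff_imp]
  rintro ⟨hC, hX⟩
  have hs : ∑ i, (p.1.dom i (G.Xrow i) + p.2.dom i (G.Xrow i)) = 1 := by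
    rw [Finset.sum_congr rfl (fun i _ => hX i)]; simp
  rw [Finset.sum_add_distrib] at hs
  exact ⟨size_RS G.Xrow G.hX p.1 hC.1.w_pos hC.1.h_pos (by omega),
    size_RS G.Xrow G.hX p.2 hC.2.w_pos hC.2.h_pos (by omega)⟩

lemma sum_NB (G : GridDiagram n) (j : ZMod n) (x : GridState n) :
    ∑ p ∈ (TS G j x).filter NB, fP G x p = 0 := by
  have key : ∀ p ∈ (TS G j x).filter NB, Tr x p (gi p) ∧ gi (gi p) = p ∧ gi p ≠ p := by
    intro p hp
    rw [Finset.mem_filter, mem_TS] at hp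
    exact tr_all x p hp.1.1 hp.2
  refine Finset.sum_involution (fun p _ => gi p) ?_ ?_ ?_ ?_
  · intro p hp
    have k := key p hp
    rw [Finset.mem_filter, mem_TS] at hp
    rw [← fP_eq G x p (gi p) hp.1.1 k.1.1 k.1.2.2.1]
    unfold fP
    rw [← Finsupp.single_add, CharTwo.add_self_eq_zero, Finsupp.single_zero]
  · intro p hp _
    exact (key p hp).2.2
  · intro p hp
    have k := key p hp
    rw [Finset.mem_filter, mem_TS] at hp ⊢
    refine ⟨⟨k.1.1, ?_⟩, k.1.2.1⟩
    intro i
    rw [← k.1.2.2.1.2]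
    exact hp.1.2 i
  · intro p hp
    exact (key p hp).2.1

/-- vertical annulus pair -/
def PV (x : GridState n) (j : ZMod n) : Rc n × Rc n :=
  (⟨j, 1, x j, (x (j + 1) - x j).val⟩, ⟨j, 1, x (j + 1), (x j - x (j + 1)).val⟩)

/-- horizontal annulus pair in row `s` -/
def PH (x : GridState n) (s : ZMod n) : Rc n × Rc n :=
  (⟨x.symm s, (x.symm (s + 1) - x.symm s).val, s, 1⟩,
   ⟨x.symm (s + 1), (x.symm s - x.symm (s + 1)).val, s, 1⟩)

lemma cast_val (a : ZMod n) : ((a.val : ℕ) : ZMod n) = a := ZMod.natCast_zmod_val a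

lemma one_ne (hn : 2 ≤ n) : (1 : ZMod n) ≠ 0 := by
  haveI : Fact (1 < n) := ⟨hn⟩
  exact one_ne_zero

lemma val_add_val_neg (a b : ZMod n) (h : a ≠ b) : (a - b).val + (b - a).val = n := by
  have h' : a - b ≠ 0 := sub_ne_zero.2 h
  haveI : NeZero (a - b) := ⟨h'⟩
  have := ZMod.val_neg_of_ne_zero (a - b)
  rw [neg_sub] at this
  have := ZMod.val_lt (a - b)
  omega

lemma j_ne (hn : 2 ≤ n) (j : ZMod n) : j + 1 ≠ j := by
  intro e
  exact one_ne hn (by simpa using e)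

lemma PV_CP (hn : 2 ≤ n) (x : GridState n) (j : ZMod n) : CP x (PV x j) := by
  have h1 : IsR x (PV x j).1 := by
    refine ⟨rfl, ?_, ?_⟩
    · simp [PV, cast_val]
    · simpa [PV] using one_ne hn
  refine ⟨h1, ?_, ?_, ?_⟩
  · have := tgt_a h1
    simpa [PV, cast_val] using this
  · have := tgt_b h1
    simpa [PV, cast_val] using this
  · simpa [PV] using one_ne hn

lemma PH_CP (hn : 2 ≤ n) (x : GridState n) (s : ZMod n) : CP x (PH x s) := by
  have hne : x.symm (s + 1) ≠ x.symm s := fun e => j_ne hn s (x.symm.injective e)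
  have h1 : IsR x (PH x s).1 := by
    refine ⟨?_, ?_, ?_⟩
    · simp [PH]
    · simp [PH, cast_val]
    · simpa [PH, cast_val, sub_eq_zero] using hne
  refine ⟨h1, ?_, ?_, ?_⟩
  · have := tgt_b h1
    simpa [PH, cast_val] using this
  · have := tgt_a h1
    simpa [PH, cast_val] using this
  · simpa [PH, cast_val, sub_eq_zero] using hne.symm

lemma PV_dom (hn : 2 ≤ n) (x : GridState n) (j i k : ZMod n) :
    (PV x j).1.dom i k + (PV x j).2.dom i k = if i = j then 1 else 0 := by
  have hne : x (j + 1) ≠ x j := fun e => j_ne hn j (x.injective e)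
  simp only [PV, Rc.dom, kap_one, ← mul_add]
  have := kap_add (x j) (x (j + 1) - x j).val (x j - x (j + 1)).val k
  rw [cast_val, add_sub_cancel, val_add_val_neg _ _ hne, kap_full] at this
  rw [← this]
  simp [eq_comm]

lemma PH_dom (hn : 2 ≤ n) (x : GridState n) (s i k : ZMod n) :
    (PH x s).1.dom i k + (PH x s).2.dom i k = if k = s then 1 else 0 := by
  have hne : x.symm (s + 1) ≠ x.symm s := fun e => j_ne hn s (x.symm.injective e)
  simp only [PH, Rc.dom, kap_one, ← add_mul]
  have := kap_add (x.symm s) (x.symm (s + 1) - x.symm s).val (x.symm s - x.symm (s + 1)).val i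
  rw [cast_val, add_sub_cancel, val_add_val_neg _ _ hne, kap_full] at this
  rw [← this]
  simp [eq_comm]

lemma mc_thin_w (hn : 2 ≤ n) (x : GridState n) (a s : ZMod n) (h : ℕ) (hh : h < n) :
    mc x ⟨a, 1, s, h⟩ = 0 := by
  unfold mc
  simp only
  have h1 := kap_end a (show 1 < n by omega)
  have h2 := kap_end s hh
  rw [h1, h2]
  simp only [mul_zero, add_zero, zero_mul]
  apply Finset.sum_eq_zero
  intro k _
  split_ifs with e
  · rfl
  · rw [kap_one, if_neg (fun e' => e (Or.inl e'.symm)), zero_mul]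

lemma mc_thin_h (hn : 2 ≤ n) (x : GridState n) (a s : ZMod n) (w : ℕ) (hw : w < n)
    (hx : x a = s ∨ x (a + w) = s) :
    mc x ⟨a, w, s, 1⟩ = 0 := by
  unfold mc
  simp only
  have h1 := kap_end s (show 1 < n by omega)
  have h2 := kap_end a hw
  rw [h1, h2]
  simp only [mul_zero, add_zero]
  apply Finset.sum_eq_zero
  intro k _
  split_ifs with e
  · rfl
  · rw [kap_one, if_neg, mul_zero]
    intro e'
    rcases hx with hx | hx
    · exact e (Or.inl (x.injective (by rw [hx, e'])))
    · exact e (Or.inr (x.injective (by rw [hx, e'])))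

lemma PV_tgt (x : GridState n) (j : ZMod n) : tgt (tgt x (PV x j).1) (PV x j).2 = x := by
  ext k
  simp [tgt, PV]

lemma PH_tgt (x : GridState n) (s : ZMod n) : tgt (tgt x (PH x s).1) (PH x s).2 = x := by
  ext k
  simp only [tgt, PH, cast_val, add_sub_cancel, Equiv.trans_apply]
  rw [Equiv.swap_comm]
  simp

lemma PV_fP (G : GridDiagram n) (x : GridState n) (j : ZMod n) :
    fP G x (PV x j) = Finsupp.single x (Vv j) := by
  have hn := two_le G
  unfold fP
  rw [PV_tgt, wtc_mul]
  simp only [PV_dom hn]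
  have m1 : mc x (PV x j).1 = 0 := mc_thin_w hn _ _ _ _ (ZMod.val_lt _)
  have m2 : mc (tgt x (PV x j).1) (PV x j).2 = 0 := mc_thin_w hn _ _ _ _ (ZMod.val_lt _)
  rw [m1, m2]
  simp [pow_ite, Finset.prod_ite_eq']

lemma PH_fP (G : GridDiagram n) (x : GridState n) (l : ZMod n) :
    fP G x (PH x (G.Orow l)) = Finsupp.single x (Vv l) := by
  have hn := two_le G
  have hC := PH_CP hn x (G.Orow l)
  unfold fP
  rw [PH_tgt, wtc_mul]
  simp only [PH_dom hn]
  have m1 : mc x (PH x (G.Orow l)).1 = 0 := mc_thin_h hn _ _ _ _ (ZMod.val_lt _) (Or.inl hC.1.1)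
  have m2 : mc (tgt x (PH x (G.Orow l)).1) (PH x (G.Orow l)).2 = 0 :=
    mc_thin_h hn _ _ _ _ (ZMod.val_lt _) (Or.inl hC.2.1)
  rw [m1, m2]
  simp [pow_ite, Finset.prod_ite_eq', G.hO.1.eq_iff]

lemma val_of_cast {a : ZMod n} {h : ℕ} (e : (h : ZMod n) = a) (hh : h < n) : h = a.val := by
  rw [← e, ZMod.val_natCast_of_lt hh]

lemma bad_eq (G : GridDiagram n) (j : ZMod n) (x : GridState n) :
    (TS G j x).filter (fun p => ¬ NB p) = {PV x j, PH x (G.Xrow j)} := by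
  have hn := two_le G
  ext p
  rw [Finset.mem_filter, mem_TS, Finset.mem_insert, Finset.mem_singleton]
  constructor
  · rintro ⟨⟨hC, hX⟩, hN⟩
    obtain ⟨⟨a₁, w₁, s₁, h₁⟩, ⟨a₂, w₂, s₂, h₂⟩⟩ := p
    obtain ⟨c1, c2⟩ := hC
    have d1 := c1.1
    have d2 := c1.2.1
    have d4 := c2.1
    have d5 := c2.2.1
    have t1 := tgt_a c1
    have t2 := tgt_b c1
    have pos1 := c1.w_pos
    have pos2 := c2.w_pos
    have pos3 := c1.h_pos
    have pos4 := c2.h_pos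
    rw [NB, not_and_or, not_not, not_not] at hN
    simp only at d1 d2 d4 d5 t1 t2 pos1 pos2 pos3 pos4 hN
    rcases hN with ⟨e1, e2⟩ | ⟨e1, e2⟩
    · right
      have es : s₂ = s₁ := by rw [← d4, ← e1, t2]
      subst e1 es
      have eh : s₂ + (h₁ : ZMod n) = s₂ + h₂ := by rw [← d5, ← e2, t1]
      have eh' : (h₁ : ZMod n) = h₂ := add_left_cancel eh
      have ew : ((w₁ + w₂ : ℕ) : ZMod n) = 0 := by
        push_cast
        have : a₁ + ((w₁ : ZMod n) + w₂) = a₁ + 0 := by rw [← add_assoc, ← e2, add_zero]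
        exact add_left_cancel this
      let X' := (Equiv.ofBijective G.Xrow G.hX).symm
      have hX' : ∀ k, G.Xrow (X' k) = k := fun k => Equiv.ofBijective_apply_symm_apply G.Xrow G.hX k
      obtain ⟨r1, r2, r3, r4⟩ := core hn X' X'.bijective s₂ (G.Xrow j) a₁ h₁ h₂ w₁ w₂ pos3 pos4 pos1 pos2
        eh' ew (by
          intro k
          have := hX (X' k)
          simp only [Rc.dom, hX'] at this
          rw [mul_comm, mul_comm (kap s₂ h₂ k), this]
          congr 1
          rw [← G.hX.1.eq_iff, hX'])
      subst r1 r2 r3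
      have ea : a₁ = x.symm (G.Xrow j) := by rw [← d1]; simp
      have eb : a₁ + (w₁ : ZMod n) = x.symm (G.Xrow j + 1) := by
        rw [Equiv.eq_symm_apply, d2]; simp
      unfold PH
      have ew1 : w₁ = (x.symm (G.Xrow j + 1) - x.symm (G.Xrow j)).val := by
        apply val_of_cast _ (by omega)
        rw [← eb, ← ea]; ring
      have ew2 : w₂ = (x.symm (G.Xrow j) - x.symm (G.Xrow j + 1)).val := by
        apply val_of_cast _ (by omega)
        rw [← eb, ← ea]
        push_cast at ew
        linear_combination ew
      rw [← eb, ← ea] at ew1 ew2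
      rw [← eb, ← ea, ← ew1, ← ew2]
    · left
      have es : s₂ = s₁ + h₁ := by rw [← d4, ← e1, t1]
      subst e1 es
      have ew : (w₁ : ZMod n) = w₂ := add_left_cancel e2
      have eh : ((h₁ + h₂ : ℕ) : ZMod n) = 0 := by
        push_cast
        have : s₁ + ((h₁ : ZMod n) + h₂) = s₁ + 0 := by rw [← add_assoc, ← d5, ← e2, add_zero, t2]
        exact add_left_cancel this
      obtain ⟨r1, r2, r3, r4⟩ := core hn G.Xrow G.hX a₁ j s₁ w₁ w₂ h₁ h₂ pos1 pos2 pos3 pos4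
        ew eh hX
      subst r1 r2 r3
      simp only [Nat.cast_one] at d2
      subst d1
      unfold PV
      have eh1 : h₁ = (x (a₁ + 1) - x a₁).val := by
        apply val_of_cast _ (by omega)
        rw [d2]; ring
      have eh2 : h₂ = (x a₁ - x (a₁ + 1)).val := by
        apply val_of_cast _ (by omega)
        rw [d2]
        push_cast at eh
        linear_combination eh
      rw [← eh1, ← eh2, d2]
  · rintro (rfl | rfl)
    · refine ⟨⟨PV_CP hn x j, ?_⟩, ?_⟩
      · intro i; exact PV_dom hn x j i _
      · simp [NB, PV]
    · refine ⟨⟨PH_CP hn x _, ?_⟩, ?_⟩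
      · intro i; rw [PH_dom hn x _ i _]
        simp [G.hX.1.eq_iff]
      · simp [NB, PH, cast_val]

lemma sum_TS (G : GridDiagram n) (l : ZMod n) (j : ZMod n) (hl : G.Orow l = G.Xrow j)
    (x : GridState n) :
    ∑ p ∈ TS G j x, fP G x p = Finsupp.single x (Vv l + Vv j) := by
  have hn := two_le G
  rw [← Finset.sum_filter_add_sum_filter_not (TS G j x) NB, sum_NB, zero_add, bad_eq,
    Finset.sum_pair, PV_fP, ← hl, PH_fP, ← Finsupp.single_add, add_comm]
  intro e
  have e1 := congrArg (fun p => p.1.a) e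
  have e2 := congrArg (fun p => p.2.a) e
  simp only [PV, PH] at e1 e2
  have e2 := e1.symm.trans e2
  exact j_ne hn (G.Xrow j) (x.symm.injective e2).symm

end

section
set_option linter.unusedSectionVars false
open Finset
variable {n : ℕ} [NeZero n]

lemma basisMap_single (f : GridState n → GC n) (x : GridState n) (c : Rng n) :
    basisMap f (Finsupp.single x c) = c • f x := by
  simp [basisMap]

lemma map_ext {φ ψ : GC n →ₗ[Rng n] GC n}
    (h : ∀ x, φ (Finsupp.single x 1) = ψ (Finsupp.single x 1)) : φ = ψ := by
  apply Finsupp.lhom_ext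
  intro x c
  have : (Finsupp.single x c : GC n) = c • Finsupp.single x 1 := by simp
  rw [this, map_smul, map_smul, h]

/-- rectangles counted by a given `X`-multiplicity function -/
def cset (G : GridDiagram n) (e : ZMod n → ℕ) (x : GridState n) : Finset (Rc n) :=
  (RS n).filter fun r => IsR x r ∧ ∀ i, r.dom i (G.Xrow i) = e i

/-- map counting rectangles with a given `X`-multiplicity function -/
def cmap (G : GridDiagram n) (e : ZMod n → ℕ) : GC n →ₗ[Rng n] GC n :=
  basisMap fun x => ∑ r ∈ cset G e x, Finsupp.single (tgt x r) (wtc G x r)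

/-- indicator multiplicity of `X_j` -/
def ind (j : ZMod n) : ZMod n → ℕ := fun i => if i = j then 1 else 0

lemma cmap_comp (G : GridDiagram n) (e e' : ZMod n → ℕ) (x : GridState n) :
    cmap G e' (cmap G e (Finsupp.single x 1)) =
      ∑ p ∈ RS n ×ˢ RS n, if CP x p ∧ (∀ i, p.1.dom i (G.Xrow i) = e i) ∧
        (∀ i, p.2.dom i (G.Xrow i) = e' i) then fP G x p else 0 := by
  unfold cmap
  rw [basisMap_single, one_smul, map_sum, Finset.sum_product]
  unfold cset
  rw [Finset.sum_filter]
  apply Finset.sum_congr rfl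
  intro r _
  by_cases h : IsR x r ∧ ∀ i, r.dom i (G.Xrow i) = e i
  · rw [if_pos h, basisMap_single, Finset.smul_sum, Finset.sum_filter]
    apply Finset.sum_congr rfl
    intro r' _
    by_cases h' : IsR (tgt x r) r' ∧ ∀ i, r'.dom i (G.Xrow i) = e' i
    · rw [if_pos h', if_pos ⟨⟨h.1, h'.1⟩, h.2, h'.2⟩]
      simp [fP]
    · rw [if_neg h', if_neg]
      rintro ⟨a, b, c⟩
      exact h' ⟨a.2, c⟩
  · rw [if_neg h]
    symm
    apply Finset.sum_eq_zero
    intro r' _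
    rw [if_neg]
    rintro ⟨a, b, c⟩
    exact h ⟨a.1, b⟩

lemma cmap_commut (G : GridDiagram n) (l j : ZMod n) (hl : G.Orow l = G.Xrow j) :
    cmap G 0 ∘ₗ cmap G (ind j) + cmap G (ind j) ∘ₗ cmap G 0 =
      (Vv l + Vv j) • (LinearMap.id : GC n →ₗ[Rng n] GC n) := by
  apply map_ext
  intro x
  simp only [LinearMap.add_apply, LinearMap.comp_apply, LinearMap.smul_apply, LinearMap.id_apply]
  rw [cmap_comp, cmap_comp, ← Finset.sum_add_distrib]
  have := sum_TS G l j hl x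
  unfold TS at this
  rw [Finset.sum_filter] at this
  rw [Finsupp.smul_single, smul_eq_mul, mul_one, ← this]
  apply Finset.sum_congr rfl
  intro p _
  by_cases hC : CP x p
  · simp only [hC, true_and]
    by_cases h1 : (∀ i, p.1.dom i (G.Xrow i) = ind j i) ∧ (∀ i, p.2.dom i (G.Xrow i) = (0 : ZMod n → ℕ) i)
    · rw [if_pos h1, if_neg, if_pos, add_zero]
      · intro i
        rw [h1.1, h1.2]; simp [ind]
      · rintro ⟨h2, _⟩
        have a := h1.1 j
        rw [h2 j] at a
        simp [ind] at a
    · rw [if_neg h1, zero_add]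
      congr 1
      apply propext
      constructor
      · rintro ⟨h2, h3⟩ i
        rw [h2, h3]; simp [ind]
      · intro h
        have hz : ∀ i, i ≠ j → p.1.dom i (G.Xrow i) = 0 ∧ p.2.dom i (G.Xrow i) = 0 := by
          intro i hi
          have := h i
          rw [if_neg hi] at this
          omega
        have hj := h j
        rw [if_pos rfl] at hj
        rcases Nat.eq_zero_or_pos (p.1.dom j (G.Xrow j)) with h0 | h0
        · constructor
          · intro i
            by_cases hi : i = j
            · rw [hi]; exact h0
            · exact (hz i hi).1
          · intro i
            by_cases hi : i = j
            · rw [hi, ind, if_pos rfl]; omega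
            · rw [ind, if_neg hi]; exact (hz i hi).2
        · exfalso
          apply h1
          constructor
          · intro i
            by_cases hi : i = j
            · rw [hi, ind, if_pos rfl]; omega
            · rw [ind, if_neg hi]; exact (hz i hi).1
          · intro i
            by_cases hi : i = j
            · rw [hi]; simp only [Pi.zero_apply]; omega
            · exact (hz i hi).2
  · simp [hC]

end

section
set_option linter.unusedSectionVars false
open Finset
variable {n : ℕ} [NeZero n]

lemma pr_natCast (k : ℕ) : pr ((k : ℕ) : ZMod (2 * n)) = (k : ZMod n) := by
  unfold pr; simp

lemma pr_add (a b : ZMod (2 * n)) : pr (a + b) = pr a + pr b := by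
  unfold pr; exact map_add _ _ _

lemma pr_sub (a b : ZMod (2 * n)) : pr (a - b) = pr a - pr b := by
  unfold pr; exact map_sub _ _ _

lemma pr_one : pr (1 : ZMod (2 * n)) = 1 := by
  unfold pr; exact map_one _

lemma pr_eq_val (a : ZMod (2 * n)) : pr a = (a.val : ZMod n) := by
  conv_lhs => rw [← ZMod.natCast_zmod_val a]
  rw [pr_natCast]

lemma pr_surj (k : ZMod n) : ∃ p : ZMod (2 * n), pr p = k :=
  ⟨((k.val : ℕ) : ZMod (2 * n)), by rw [pr_natCast, ZMod.natCast_zmod_val]⟩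

lemma pr_eq_zero_iff (a : ZMod (2 * n)) : pr a = 0 ↔ a = 0 ∨ a = (n : ZMod (2 * n)) := by
  have hn : 0 < n := Nat.pos_of_ne_zero (NeZero.ne n)
  constructor
  · intro h
    rw [pr_eq_val, ZMod.natCast_eq_zero_iff] at h
    have hlt := ZMod.val_lt a
    obtain ⟨c, hc⟩ := h
    have hc2 : c < 2 := by
      by_contra h'
      nlinarith
    rw [← ZMod.natCast_zmod_val a, hc]
    interval_cases c
    · left; simp
    · right; simp
  · rintro (rfl | rfl)
    · unfold pr; exact map_zero _
    · rw [pr_natCast]; simp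

lemma nn_ne : (n : ZMod (2 * n)) ≠ 0 := by
  have hn : 0 < n := Nat.pos_of_ne_zero (NeZero.ne n)
  intro h
  rw [ZMod.natCast_eq_zero_iff] at h
  have := Nat.le_of_dvd hn h
  omega

lemma ind_pr (p c : ZMod (2 * n)) :
    ((if p = c then 1 else 0) + (if p = c + (n : ZMod (2 * n)) then 1 else 0) : ℤ) =
      if pr p = pr c then 1 else 0 := by
  have h : pr p = pr c ↔ p = c ∨ p = c + (n : ZMod (2 * n)) := by
    rw [← sub_eq_zero, ← pr_sub, pr_eq_zero_iff, sub_eq_zero, sub_eq_iff_eq_add, add_comm c]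
  have hne : ¬ (p = c ∧ p = c + (n : ZMod (2 * n))) := by
    rintro ⟨h1, h2⟩
    rw [h1] at h2
    exact nn_ne (by simpa using h2.symm)
  by_cases h1 : p = c <;> by_cases h2 : p = c + (n : ZMod (2 * n)) <;> simp_all

lemma ite_pair (p : ZMod (2 * n) × ZMod (2 * n)) (a b : ZMod (2 * n)) :
    (if p = (a, b) then 1 else 0 : ℤ) = (if p.1 = a then 1 else 0) * (if p.2 = b then 1 else 0) := by
  obtain ⟨p, q⟩ := p
  by_cases h1 : p = a <;> by_cases h2 : q = b <;> simp [h1, h2]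

/-- indicator of a coordinate -/
def dl (p c : ZMod (2 * n)) : ℤ := if p = c then 1 else 0

lemma cornerA_eq (r : Rect (2 * n)) (p : ZMod (2 * n) × ZMod (2 * n)) :
    cornerA r p = dl p.1 r.cE * dl p.2 r.rS + dl p.1 r.cW * dl p.2 r.rN -
      dl p.1 r.cW * dl p.2 r.rS - dl p.1 r.cE * dl p.2 r.rN := by
  simp only [cornerA, ite_pair, dl]

lemma ind_pr_dl (p c : ZMod (2 * n)) :
    (if pr p = pr c then 1 else 0 : ℤ) = dl p c + dl p (c + (n : ZMod (2 * n))) :=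
  (ind_pr p c).symm

lemma corner_sum (r : Rect (2 * n)) (p : ZMod (2 * n) × ZMod (2 * n)) :
    cornerA r p + cornerA (trN r) p + cornerA (trE r) p + cornerA (trN (trE r)) p =
      (if pr p.1 = pr r.cE then 1 else 0) * (if pr p.2 = pr r.rS then 1 else 0) +
      (if pr p.1 = pr r.cW then 1 else 0) * (if pr p.2 = pr r.rN then 1 else 0) -
      (if pr p.1 = pr r.cW then 1 else 0) * (if pr p.2 = pr r.rS then 1 else 0) -
      (if pr p.1 = pr r.cE then 1 else 0) * (if pr p.2 = pr r.rN then 1 else 0) := by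
  rw [cornerA_eq, cornerA_eq, cornerA_eq, cornerA_eq]
  simp only [ind_pr_dl]
  dsimp only [trN, trE]
  ring

lemma cornerB_eq (r : Rect (2 * n)) (p : ZMod (2 * n) × ZMod (2 * n)) :
    cornerB r p = - cornerA r p := by
  simp only [cornerA, cornerB]
  ring

/-- descended form of the boundary condition -/
def CC (x y : GridState n) (E W S N : ZMod n) : Prop :=
  ∀ k l : ZMod n, ((if k = E then 1 else 0) * (if l = S then 1 else 0) +
      (if k = W then 1 else 0) * (if l = N then 1 else 0) -
      (if k = W then 1 else 0) * (if l = S then 1 else 0) -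
      (if k = E then 1 else 0) * (if l = N then 1 else 0) : ℤ) =
      (if y k = l then 1 else 0) - (if x k = l then 1 else 0)

lemma isRect4_iff (x y : GridState n) (r : Rect (2 * n)) :
    IsRect4From x y r ↔ r.cW ≠ r.cE ∧ r.rS ≠ r.rN ∧
      CC x y (pr r.cE) (pr r.cW) (pr r.rS) (pr r.rN) := by
  unfold IsRect4From
  refine and_congr Iff.rfl (and_congr Iff.rfl ?_)
  constructor
  · rintro ⟨h, _⟩ k l
    obtain ⟨p, rfl⟩ := pr_surj k
    obtain ⟨q, rfl⟩ := pr_surj l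
    have := h (p, q)
    rw [corner_sum] at this
    exact this
  · intro h
    have hA : ∀ p, cornerA r p + cornerA (trN r) p + cornerA (trE r) p + cornerA (trN (trE r)) p
      = stInd y p - stInd x p := by
      intro p
      rw [corner_sum]
      exact h _ _
    refine ⟨hA, fun p => ?_⟩
    simp only [cornerB_eq]
    linarith [hA p]

lemma CC_iff (x y : GridState n) (E W S N : ZMod n) (h1 : W ≠ E) (h2 : S ≠ N) :
    CC x y E W S N ↔ x W = S ∧ x E = N ∧ y = (Equiv.swap W E).trans x := by
  constructor
  · intro h
    have a1 := h W S
    have a2 := h E N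
    have a3 := h E S
    have a4 := h W N
    simp only [h1, h2, h1.symm, h2.symm, if_true, if_false] at a1 a2 a3 a4
    have b1 : x W = S := by split_ifs at a1 <;> first | assumption | omega
    have b2 : x E = N := by split_ifs at a2 <;> first | assumption | omega
    have b3 : y E = S := by split_ifs at a3 <;> first | assumption | omega
    have b4 : y W = N := by split_ifs at a4 <;> first | assumption | omega
    refine ⟨b1, b2, ?_⟩
    apply Equiv.ext
    intro k
    rw [Equiv.trans_apply, Equiv.swap_apply_def]
    split_ifs with c1 c2
    · rw [c1, b4, b2]
    · rw [c2, b3, b1]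
    · have a := h k (x k)
      simp only [c1, c2, if_true, if_false] at a
      by_contra c3
      rw [if_neg c3] at a
      omega
  · rintro ⟨rfl, rfl, rfl⟩ k l
    simp only [Equiv.trans_apply, Equiv.swap_apply_def]
    by_cases c1 : k = W
    · subst c1
      simp only [h1, if_true, if_false]
      simp [eq_comm]
    · by_cases c2 : k = E
      · subst c2
        simp only [h1.symm, if_true, if_false]
        simp [eq_comm]
      · simp [c1, c2]

/-- one dimensional indicator -/
def cI (u v p : ZMod (2 * n)) : ℕ := if inIco u v p then 1 else 0

lemma mult_eq (r : Rect (2 * n)) (p : ZMod (2 * n) × ZMod (2 * n)) :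
    r.mult p = cI r.cW r.cE p.1 * cI r.rS r.rN p.2 := by
  unfold Rect.mult cI
  by_cases h1 : inIco r.cW r.cE p.1 <;> by_cases h2 : inIco r.rS r.rN p.2 <;> simp [h1, h2]

lemma fibre_sum (u v : ZMod (2 * n)) (i : ZMod n) :
    (∑ p : ZMod (2 * n), if pr p = i then cI u v p else 0) = kap (pr u) (v - u).val i := by
  rw [← Equiv.sum_comp (Equiv.addLeft u), sum_range_zmod (2 * n)]
  have hv := ZMod.val_lt (v - u)
  unfold kap
  have : ∀ t ∈ range (2 * n), (if pr ((Equiv.addLeft u) (t : ZMod (2 * n))) = i then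
      cI u v ((Equiv.addLeft u) (t : ZMod (2 * n))) else 0) =
      if t < (v - u).val then (if pr u + (t : ZMod n) = i then 1 else 0) else 0 := by
    intro t ht
    rw [Finset.mem_range] at ht
    simp only [Equiv.coe_addLeft, pr_add, pr_natCast, cI, inIco, add_sub_cancel_left,
      ZMod.val_natCast_of_lt ht]
    split_ifs <;> rfl
  rw [Finset.sum_congr rfl this, ← Finset.sum_filter]
  congr 1
  ext t
  simp only [Finset.mem_filter, Finset.mem_range]
  omega

/-- projection of a rectangle of the cover -/
def rproj (R : Rect (2 * n)) : Rc n :=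
  ⟨pr R.cW, (R.cE - R.cW).val, pr R.rS, (R.rN - R.rS).val⟩

lemma count_eq (R : Rect (2 * n)) (i k : ZMod n) :
    (∑ p : ZMod (2 * n) × ZMod (2 * n), if pr p.1 = i ∧ pr p.2 = k then R.mult p else 0) =
      (rproj R).dom i k := by
  unfold Rc.dom rproj
  simp only
  rw [← fibre_sum, ← fibre_sum, Finset.sum_mul_sum, Fintype.sum_prod_type]
  apply Finset.sum_congr rfl
  intro p _
  apply Finset.sum_congr rfl
  intro q _
  rw [mult_eq]
  by_cases h1 : pr p = i <;> by_cases h2 : pr q = k <;> simp [h1, h2]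

lemma O4_eq (G : GridDiagram n) (R : Rect (2 * n)) (i : ZMod n) :
    O4count G R i = (rproj R).dom i (G.Orow i) := count_eq R i _

lemma X4_eq (G : GridDiagram n) (R : Rect (2 * n)) (i : ZMod n) :
    X4count G R i = (rproj R).dom i (G.Xrow i) := count_eq R i _

lemma fibre_ph (u v : ZMod (2 * n)) (k : ZMod n) :
    (∑ p : ZMod (2 * n), if pr p = k then ((cI u v (p - 1) + cI u v p : ℕ) : ℚ) / 2 else 0) =
      ph (pr u) (v - u).val k := by
  unfold ph
  have h1 := fibre_sum u v k
  have h2 := fibre_sum u v (k - 1)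
  rw [← Equiv.sum_comp (Equiv.subRight (1 : ZMod (2 * n)))] at h2
  rw [← h1, ← h2]
  push_cast
  rw [← Finset.sum_add_distrib, Finset.sum_div]
  apply Finset.sum_congr rfl
  intro p _
  simp only [Equiv.subRight_apply, pr_sub, pr_one, sub_left_inj]
  split_ifs <;> simp

lemma rpm4_eq (w : GridState n) (R : Rect (2 * n)) : rpm4 w R = pmc w (rproj R) := by
  unfold rpm4 pm4 pmc rproj Rect.dom4
  simp only [mult_eq]
  simp only [← fibre_ph, Finset.sum_mul_sum]
  rw [Fintype.sum_prod_type, Finset.sum_div, Finset.sum_comm]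
  apply Finset.sum_congr rfl
  intro p _
  have : ∀ k : ZMod n, (∑ q : ZMod (2 * n), (if pr p = k then
      ((cI R.cW R.cE (p - 1) + cI R.cW R.cE p : ℕ) : ℚ) / 2 else 0) *
      (if pr q = w k then ((cI R.rS R.rN (q - 1) + cI R.rS R.rN q : ℕ) : ℚ) / 2 else 0)) =
      if pr p = k then ∑ q : ZMod (2 * n), ((cI R.cW R.cE (p - 1) + cI R.cW R.cE p : ℕ) : ℚ) / 2 *
      (if pr q = w k then ((cI R.rS R.rN (q - 1) + cI R.rS R.rN q : ℕ) : ℚ) / 2 else 0) else 0 := by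
    intro k
    split_ifs <;> simp
  rw [Finset.sum_congr rfl (fun k _ => this k), Finset.sum_ite_eq, if_pos (Finset.mem_univ _),
    Finset.sum_div]
  apply Finset.sum_congr rfl
  intro q _
  simp only [eq_comm (a := w (pr p))]
  split_ifs
  · push_cast; ring
  · simp

end

section
set_option linter.unusedSectionVars false
open Finset
variable {n : ℕ} [NeZero n]

/-- the normalized lift of a rectangle -/
def rlift (r : Rc n) : Rect (2 * n) :=
  ⟨((r.a.val : ℕ) : ZMod (2 * n)), ((r.a.val : ℕ) : ZMod (2 * n)) + ((r.w : ℕ) : ZMod (2 * n)),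
   ((r.s.val : ℕ) : ZMod (2 * n)), ((r.s.val : ℕ) : ZMod (2 * n)) + ((r.h : ℕ) : ZMod (2 * n))⟩

lemma rproj_rlift (r : Rc n) (hr : r ∈ RS n) : rproj (rlift r) = r := by
  rw [mem_RS] at hr
  unfold rproj rlift
  simp only [pr_natCast, ZMod.natCast_zmod_val, add_sub_cancel_left, ZMod.val_natCast_of_lt hr.1,
    ZMod.val_natCast_of_lt hr.2]

lemma pr_val (a : ZMod (2 * n)) (h : a.val < n) : (((pr a).val : ℕ) : ZMod (2 * n)) = a := by
  rw [pr_eq_val, ZMod.val_natCast_of_lt h, ZMod.natCast_zmod_val]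

lemma rlift_rproj (R : Rect (2 * n)) (h : normal4 R) : rlift (rproj R) = R := by
  unfold rproj rlift
  simp only [pr_val _ h.1, pr_val _ h.2, ZMod.natCast_zmod_val, add_sub_cancel]

lemma normal_rlift (r : Rc n) : normal4 (rlift r) := by
  have hn : 0 < n := Nat.pos_of_ne_zero (NeZero.ne n)
  unfold normal4 rlift
  have h1 := ZMod.val_lt r.a
  have h2 := ZMod.val_lt r.s
  simp only
  rw [ZMod.val_natCast_of_lt (by omega), ZMod.val_natCast_of_lt (by omega)]
  exact ⟨h1, h2⟩

lemma rproj_mem (R : Rect (2 * n)) : rproj R ∈ RS n := by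
  rw [mem_RS]
  exact ⟨ZMod.val_lt _, ZMod.val_lt _⟩

lemma rproj_aw (R : Rect (2 * n)) : (rproj R).a + ((rproj R).w : ZMod n) = pr R.cE := by
  unfold rproj
  simp only [← pr_eq_val, pr_sub, add_sub_cancel]

lemma rproj_sh (R : Rect (2 * n)) : (rproj R).s + ((rproj R).h : ZMod n) = pr R.rN := by
  unfold rproj
  simp only [← pr_eq_val, pr_sub, add_sub_cancel]

lemma isR_iff (x : GridState n) (R : Rect (2 * n)) :
    IsR x (rproj R) ↔ x (pr R.cW) = pr R.rS ∧ x (pr R.cE) = pr R.rN ∧ pr R.cW ≠ pr R.cE := by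
  unfold IsR
  rw [rproj_aw, rproj_sh]
  refine and_congr Iff.rfl (and_congr Iff.rfl ?_)
  rw [← rproj_aw R]
  show _ ↔ (rproj R).a ≠ _
  simp

lemma isRect4_IsR {x y : GridState n} {R : Rect (2 * n)} :
    IsR x (rproj R) ∧ y = tgt x (rproj R) ↔
      IsRect4From x y R ∧ pr R.cW ≠ pr R.cE ∧ pr R.rS ≠ pr R.rN := by
  rw [isRect4_iff, isR_iff]
  have ht : tgt x (rproj R) = (Equiv.swap (pr R.cW) (pr R.cE)).trans x := by
    unfold tgt
    rw [rproj_aw]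
    rfl
  constructor
  · rintro ⟨⟨h1, h2, h3⟩, h4⟩
    have h5 : pr R.rS ≠ pr R.rN := by
      rw [← h1, ← h2]; exact fun e => h3 (x.injective e)
    refine ⟨⟨?_, ?_, ?_⟩, h3, h5⟩
    · intro e; exact h3 (by rw [e])
    · intro e; exact h5 (by rw [e])
    · rw [CC_iff _ _ _ _ _ _ h3 h5]
      exact ⟨h1, h2, by rw [h4, ht]⟩
  · rintro ⟨⟨_, _, hc⟩, h3, h5⟩
    rw [CC_iff _ _ _ _ _ _ h3 h5] at hc
    exact ⟨⟨hc.1, hc.2.1, h3⟩, by rw [ht]; exact hc.2.2⟩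

lemma pr_ne {u v : ZMod (2 * n)} (h : u ≠ v) (hlt : (v - u).val < n) : pr u ≠ pr v := by
  intro e
  have : pr (v - u) = 0 := by rw [pr_sub, e, sub_self]
  rw [pr_eq_val, ZMod.natCast_eq_zero_iff] at this
  have h0 := Nat.eq_zero_of_dvd_of_lt this hlt
  rw [ZMod.val_eq_zero, sub_eq_zero] at h0
  exact h h0.symm

lemma xdisj_ne (G : GridDiagram n) {R : Rect (2 * n)} (h1 : R.cW ≠ R.cE) (h2 : R.rS ≠ R.rN)
    (hX : ∀ i, (rproj R).dom i (G.Xrow i) = 0) : pr R.cW ≠ pr R.cE ∧ pr R.rS ≠ pr R.rN := by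
  have pw : 0 < (rproj R).w := by
    rw [Nat.pos_iff_ne_zero]
    intro e
    have e' : (R.cE - R.cW).val = 0 := e
    rw [ZMod.val_eq_zero, sub_eq_zero] at e'
    exact h1 e'.symm
  have ph : 0 < (rproj R).h := by
    rw [Nat.pos_iff_ne_zero]
    intro e
    have e' : (R.rN - R.rS).val = 0 := e
    rw [ZMod.val_eq_zero, sub_eq_zero] at e'
    exact h2 e'.symm
  have lw : (rproj R).w < n := by
    by_contra hc
    have hz : ∀ i, kap (rproj R).s (rproj R).h (G.Xrow i) = 0 := by
      intro i
      have := kap_ge_one (rproj R).a (show n ≤ (rproj R).w by omega) i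
      rcases Nat.mul_eq_zero.1 (hX i) with h | h <;> omega
    have := sum_comp_bij G.Xrow G.hX (fun k => kap (rproj R).s (rproj R).h k)
    rw [Finset.sum_eq_zero (fun i _ => hz i), sum_kap] at this
    omega
  have lh : (rproj R).h < n := by
    by_contra hc
    have hz : ∀ i, kap (rproj R).a (rproj R).w i = 0 := by
      intro i
      have := kap_ge_one (rproj R).s (show n ≤ (rproj R).h by omega) (G.Xrow i)
      rcases Nat.mul_eq_zero.1 (hX i) with h | h <;> omega
    have := sum_kap (rproj R).a (rproj R).w
    rw [Finset.sum_eq_zero (fun i _ => hz i)] at this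
    omega
  exact ⟨pr_ne h1 lw, pr_ne h2 lh⟩

lemma m4_eq {x : GridState n} {R : Rect (2 * n)} (h : IsR x (rproj R)) :
    m4 x (tgt x (rproj R)) R = mc x (rproj R) := by
  unfold m4 mQ4
  rw [rpm4_eq, rpm4_eq, ← mc_eq h]
  have : (2 * (mc x (rproj R) : ℚ)) / 2 = ((mc x (rproj R) : ℕ) : ℚ) := by ring
  rw [this]
  simp

lemma wt4_eq (G : GridDiagram n) {x : GridState n} {R : Rect (2 * n)} (h : IsR x (rproj R)) :
    wt4 G x (tgt x (rproj R)) R = wtc G x (rproj R) := by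
  unfold wt4 wtc
  rw [m4_eq h]
  simp only [O4_eq]

lemma diff4_eq (G : GridDiagram n) : diff4 G = cmap G 0 := by
  unfold diff4 cmap
  congr 1
  funext x
  rw [Finset.sum_sigma']
  refine Finset.sum_bij' (fun q _ => rproj q.2) (fun r _ => ⟨tgt x r, rlift r⟩) ?_ ?_ ?_ ?_ ?_
  · rintro ⟨y, R⟩ hq
    simp only [Finset.mem_sigma, Finset.mem_univ, Finset.mem_filter, true_and] at hq
    obtain ⟨h1, h2, h3⟩ := hq
    have hX : ∀ i, (rproj R).dom i (G.Xrow i) = 0 := fun i => by rw [← X4_eq]; exact h3 i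
    have := isRect4_IsR.2 ⟨h1, xdisj_ne G h1.1 h1.2.1 hX⟩
    simp only [cset, Finset.mem_filter]
    exact ⟨rproj_mem R, this.1, hX⟩
  · intro r hr
    simp only [cset, Finset.mem_filter] at hr
    have e := rproj_rlift r hr.1
    simp only [Finset.mem_sigma, Finset.mem_univ, Finset.mem_filter, true_and]
    have := (isRect4_IsR (x := x) (y := tgt x r) (R := rlift r)).1 (by rw [e]; exact ⟨hr.2.1, rfl⟩)
    refine ⟨this.1, normal_rlift r, ?_⟩
    intro i
    rw [X4_eq, e]
    exact hr.2.2 i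
  · rintro ⟨y, R⟩ hq
    simp only [Finset.mem_sigma, Finset.mem_univ, Finset.mem_filter, true_and] at hq
    obtain ⟨h1, h2, h3⟩ := hq
    have hX : ∀ i, (rproj R).dom i (G.Xrow i) = 0 := fun i => by rw [← X4_eq]; exact h3 i
    have := isRect4_IsR.2 ⟨h1, xdisj_ne G h1.1 h1.2.1 hX⟩
    simp only [rlift_rproj R h2, ← this.2]
  · intro r hr
    simp only [cset, Finset.mem_filter] at hr
    exact rproj_rlift r hr.1
  · rintro ⟨y, R⟩ hq
    simp only [Finset.mem_sigma, Finset.mem_univ, Finset.mem_filter, true_and] at hq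
    obtain ⟨h1, h2, h3⟩ := hq
    have hX : ∀ i, (rproj R).dom i (G.Xrow i) = 0 := fun i => by rw [← X4_eq]; exact h3 i
    have := isRect4_IsR.2 ⟨h1, xdisj_ne G h1.1 h1.2.1 hX⟩
    obtain ⟨hR, rfl⟩ := this
    simp only
    rw [wt4_eq G hR]

end

section
set_option linter.unusedSectionVars false
open Finset
variable {n : ℕ} [NeZero n]

/-- sign comparison of a marking position with a circle position -/
def tau (k a : ZMod n) : ℚ := if a.val ≤ k.val then 1 else -1

/-- sign comparison of circle positions -/
def sig (k a : ZMod n) : ℚ := tau k a - if k = a then 1 else 0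

lemma val_sub_one {k : ZMod n} (h : k ≠ 0) : (k - 1).val + 1 = k.val := by
  have hk : k.val ≠ 0 := fun e => h ((ZMod.val_eq_zero k).1 e)
  have hlt := ZMod.val_lt k
  have : k - 1 = ((k.val - 1 : ℕ) : ZMod n) := by
    rw [Nat.cast_sub (by omega), ZMod.natCast_zmod_val]; simp
  rw [this, ZMod.val_natCast_of_lt (by omega)]
  omega

lemma val_zero_sub_one : ((0 : ZMod n) - 1).val + 1 = n := by
  have hn : 0 < n := Nat.pos_of_ne_zero (NeZero.ne n)
  have : (0 : ZMod n) - 1 = ((n - 1 : ℕ) : ZMod n) := by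
    rw [Nat.cast_sub (by omega)]; simp
  rw [this, ZMod.val_natCast_of_lt (by omega)]
  omega

lemma tau_diff (k a : ZMod n) :
    tau k a - tau (k - 1) a = 2 * (if k = a then 1 else 0) - 2 * (if k = 0 then 1 else 0) := by
  have ha := ZMod.val_lt a
  have hka : k = a ↔ k.val = a.val := ⟨fun e => by rw [e], fun e => ZMod.val_injective n e⟩
  unfold tau
  simp only [hka]
  by_cases h : k = 0
  · subst h
    have := val_zero_sub_one (n := n)
    rw [if_pos (show a.val ≤ ((0 : ZMod n) - 1).val by omega), ZMod.val_zero]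
    by_cases h0 : a.val = 0
    · simp [h0]
    · rw [if_neg (by omega), if_neg (fun e => h0 e.symm)]
      norm_num
  · have := val_sub_one h
    rw [if_neg h]
    by_cases h1 : k.val = a.val
    · rw [if_pos (by omega), if_neg (by omega), if_pos h1]; norm_num
    · by_cases h2 : a.val ≤ k.val
      · rw [if_pos h2, if_pos (by omega), if_neg h1]; norm_num
      · rw [if_neg h2, if_neg (by omega), if_neg h1]; norm_num

lemma const_of_shift (g : ZMod n → ℚ) (h : ∀ k, g k = g (k - 1)) (k : ZMod n) : g k = g 0 := by
  have : ∀ m : ℕ, g (m : ZMod n) = g 0 := by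
    intro m
    induction m with
    | zero => simp
    | succ m ih => rw [h, ← ih]; simp
  rw [← ZMod.natCast_zmod_val k]
  exact this _

lemma kap_const (a : ZMod n) (w : ℕ) : ∃ c : ℚ, ∀ k,
    (kap a w k : ℚ) = (tau k a - tau k (a + (w : ZMod n))) / 2 + c ∧
    ph a w k = (sig k a - sig k (a + (w : ZMod n))) / 2 + c := by
  have hc := const_of_shift
    (fun k => (kap a w k : ℚ) - (tau k a - tau k (a + (w : ZMod n))) / 2) (by
    intro k
    have h1 := tau_diff k a
    have h2 := tau_diff k (a + (w : ZMod n))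
    have h3 := kap_diff a w k
    linarith)
  refine ⟨(kap a w 0 : ℚ) - (tau 0 a - tau 0 (a + (w : ZMod n))) / 2, fun k => ?_⟩
  have hk := hc k
  constructor
  · linarith
  · rw [ph_eq]
    unfold sig
    linarith

lemma sum_pts (u : ZMod n → ZMod n) (off : ℕ) {M : Type*} [AddCommMonoid M] (F : ℕ × ℕ → M) :
    ∑ p ∈ ptsOf u off, F p = ∑ k, F (2 * k.val + off, 2 * (u k).val + off) := by
  unfold ptsOf
  rw [Finset.sum_image]
  intro k _ l _ e
  simp only [Prod.mk.injEq] at e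
  exact ZMod.val_injective n (by omega)

lemma Icnt_eq (u v : ZMod n → ZMod n) (o o' : ℕ) :
    (Icnt (ptsOf u o) (ptsOf v o') : ℚ) = ∑ k, ∑ l,
      if 2 * k.val + o < 2 * l.val + o' ∧ 2 * (u k).val + o < 2 * (v l).val + o' then 1 else 0 := by
  unfold Icnt
  simp only [Finset.card_filter]
  rw [sum_pts]
  simp only [sum_pts]
  push_cast
  rfl

lemma vne {k l : ZMod n} (h : k ≠ l) : k.val ≠ l.val := fun e => h (ZMod.val_injective n e)

lemma Icnt_eq2 (u v : ZMod n → ZMod n) (o o' : ℕ) :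
    (Icnt (ptsOf v o') (ptsOf u o) : ℚ) = ∑ k, ∑ l,
      if 2 * l.val + o' < 2 * k.val + o ∧ 2 * (v l).val + o' < 2 * (u k).val + o then 1 else 0 := by
  rw [Icnt_eq, Finset.sum_comm]

lemma J_pt (K L A B : ℕ) (h1 : K ≠ L) (h2 : A ≠ B) :
    ((if K < L ∧ A < B then 1 else 0) + (if L < K ∧ B < A then 1 else 0) : ℚ) =
      (1 + (if K ≤ L then 1 else -1) * (if A ≤ B then 1 else -1)) / 2 := by
  rcases lt_or_gt_of_ne h1 with a | a <;> rcases lt_or_gt_of_ne h2 with b | b <;>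
    simp [a, b, a.le, b.le, not_lt.2 a.le, not_lt.2 b.le, not_le.2 a, not_le.2 b] <;> norm_num

lemma J_xx (x : GridState n) : Jq (ptsOf x 0) (ptsOf x 0) =
    (∑ k, ∑ l, ((1 + sig l k * sig (x l) (x k)) / 2 - (if k = l then 1 else 0) / 2)) / 2 := by
  unfold Jq
  congr 1
  trans (∑ k : ZMod n, ∑ l : ZMod n, ((if 2 * k.val + 0 < 2 * l.val + 0 ∧
      2 * (x k).val + 0 < 2 * (x l).val + 0 then 1 else 0) + 
      (if 2 * l.val + 0 < 2 * k.val + 0 ∧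
      2 * (x l).val + 0 < 2 * (x k).val + 0 then 1 else 0) : ℚ))
  · simp only [Finset.sum_add_distrib]
    rw [← Icnt_eq, ← Icnt_eq2]
  apply Finset.sum_congr rfl
  intro k _
  apply Finset.sum_congr rfl
  intro l _
  by_cases h : k = l
  · subst h
    simp [sig, tau]
  · have hx : x k ≠ x l := fun e => h (x.injective e)
    have h1 := vne h
    have h2 := vne hx
    rw [J_pt _ _ _ _ (by omega) (by omega), if_neg h]
    unfold sig tau
    have e1 : l ≠ k := fun e => h e.symm
    have e2 : x l ≠ x k := fun e => hx e.symm
    simp [e1]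

lemma J_xf (x : GridState n) (f : ZMod n → ZMod n) : Jq (ptsOf x 0) (ptsOf f 1) =
    (∑ k, ∑ l, ((1 + tau l k * tau (f l) (x k)) / 2)) / 2 := by
  unfold Jq
  congr 1
  rw [Icnt_eq, Icnt_eq2, ← Finset.sum_add_distrib]
  apply Finset.sum_congr rfl
  intro k _
  rw [← Finset.sum_add_distrib]
  apply Finset.sum_congr rfl
  intro l _
  rw [J_pt _ _ _ _ (by omega) (by omega)]
  unfold tau
  have e1 : 2 * k.val + 0 ≤ 2 * l.val + 1 ↔ k.val ≤ l.val := by omega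
  have e2 : 2 * (x k).val + 0 ≤ 2 * (f l).val + 1 ↔ (x k).val ≤ (f l).val := by omega
  simp only [e1, e2]

end

section
set_option linter.unusedSectionVars false
open Finset
variable {n : ℕ} [NeZero n]

lemma sig_anti (k l : ZMod n) : sig k l = - sig l k := by
  unfold sig tau
  by_cases h : k = l
  · subst h; simp
  · have h' : l ≠ k := fun e => h e.symm
    rcases lt_or_gt_of_ne (vne h) with a | a <;>
      simp [h, h', a.le, not_le.2 a]

/-- bilinear comparison form of two grid states -/
def bilS (u v : ZMod n → ZMod n) : ℚ := ∑ k, ∑ l, sig l k * sig (u l) (v k)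

lemma bilS_comm (u v : ZMod n → ZMod n) : bilS u v = bilS v u := by
  unfold bilS
  rw [Finset.sum_comm]
  apply Finset.sum_congr rfl
  intro k _
  apply Finset.sum_congr rfl
  intro l _
  rw [sig_anti k l, sig_anti (u k) (v l)]
  ring

lemma form_diff {x : GridState n} {r : Rc n} (h : IsR x r) (T : ZMod n → ZMod n → ℚ)
    (u : ZMod n → ZMod n) :
    (∑ k, ∑ l, T l k * T (u l) (x k)) - (∑ k, ∑ l, T l k * T (u l) (tgt x r k)) =
      ∑ l, (T l r.a - T l (r.a + r.w)) * (T (u l) r.s - T (u l) (r.s + r.h)) := by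
  have := sum_tgt h (fun k m => ∑ l, T l k * T (u l) m)
  rw [this]
  have e : ∀ l, (T l r.a - T l (r.a + r.w)) * (T (u l) r.s - T (u l) (r.s + r.h)) =
    (T l r.a * T (u l) r.s + T l (r.a + r.w) * T (u l) (r.s + r.h)) -
    (T l r.a * T (u l) (r.s + r.h) + T l (r.a + r.w) * T (u l) r.s) := fun l => by ring
  simp only [e, Finset.sum_add_distrib, Finset.sum_sub_distrib]
  ring

lemma quad_sum (p q : ZMod n → ℚ) (c d w h : ℚ) (hp : ∑ l, p l = w) (hq : ∑ l, q l = h) :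
    ∑ l, (2 * (p l - c)) * (2 * (q l - d)) =
      4 * (∑ l, p l * q l - c * h - d * w + n * c * d) := by
  have e : ∀ l, (2 * (p l - c)) * (2 * (q l - d)) =
    4 * (p l * q l) - 4 * c * q l - 4 * d * p l + 4 * c * d := fun l => by ring
  simp only [e, Finset.sum_add_distrib, Finset.sum_sub_distrib, ← Finset.mul_sum, hp, hq,
    Finset.sum_const, Finset.card_univ, ZMod.card, nsmul_eq_mul]
  ring

lemma maslov_tgt {x : GridState n} {r : Rc n} (h : IsR x r) (f : ZMod n → ZMod n)
    (hf : Function.Bijective f) :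
    MaslovOf f x - MaslovOf f (tgt x r) = 1 + 2 * (mc x r : ℚ) - 2 * ∑ i, (r.dom i (f i) : ℚ) := by
  obtain ⟨c, hc⟩ := kap_const r.a r.w
  obtain ⟨d, hd⟩ := kap_const r.s r.h
  have key : ∀ u : ZMod n → ZMod n, Function.Bijective u →
      bilS u x - bilS u (tgt x r) = 4 * (pmc u r - c * r.h - d * r.w + n * c * d) := by
    intro u hu
    unfold bilS pmc
    rw [form_diff h sig u, ← quad_sum _ _ c d r.w r.h (sum_ph r.a r.w)
      ((sum_comp_bij u hu (ph r.s r.h)).trans (sum_ph r.s r.h))]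
    apply Finset.sum_congr rfl
    intro l _
    have e1 := (hc l).2
    have e2 := (hd (u l)).2
    rw [e1, e2]
    ring
  have keyT : (∑ k, ∑ l, tau l k * tau (f l) (x k)) - (∑ k, ∑ l, tau l k * tau (f l) (tgt x r k))
      = 4 * (∑ i, (r.dom i (f i) : ℚ) - c * r.h - d * r.w + n * c * d) := by
    have s1 : ∑ k, (kap r.a r.w k : ℚ) = r.w := by exact_mod_cast sum_kap r.a r.w
    have s2 : ∑ k, (kap r.s r.h k : ℚ) = r.h := by exact_mod_cast sum_kap r.s r.h
    have s3 : ∑ i, (r.dom i (f i) : ℚ) = ∑ i, (kap r.a r.w i : ℚ) * (kap r.s r.h (f i) : ℚ) := by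
      simp [Rc.dom]
    rw [s3, form_diff h tau f, ← quad_sum _ _ c d r.w r.h s1
      ((sum_comp_bij f hf (fun k => (kap r.s r.h k : ℚ))).trans s2)]
    apply Finset.sum_congr rfl
    intro l _
    have e1 := (hc l).1
    have e2 := (hd (f l)).1
    simp only [e1, e2]
    ring
  have k1 := key x x.bijective
  have k2 := key (tgt x r) (tgt x r).bijective
  have k3 := bilS_comm x (tgt x r)
  have k4 := mc_eq h
  have jx : ∀ y : GridState n, Jq (ptsOf y 0) (ptsOf y 0) =
      bilS y y / 4 + (∑ k : ZMod n, ∑ l : ZMod n, ((1 : ℚ) / 2 - (if k = l then 1 else 0) / 2)) / 2 := by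
    intro y
    rw [J_xx]
    have e : ∀ k l : ZMod n, (1 + sig l k * sig (y l) (y k)) / 2 - (if k = l then (1:ℚ) else 0) / 2 =
      (1 / 2) * (sig l k * sig (y l) (y k)) + (1 / 2 - (if k = l then 1 else 0) / 2) := fun k l => by ring
    simp only [e]
    simp only [Finset.sum_add_distrib (f := fun l => (1 / 2) * (sig l _ * sig (y l) (y _)))]
    rw [Finset.sum_add_distrib]
    simp only [← Finset.mul_sum]
    unfold bilS
    ring
  have jf : ∀ y : GridState n, Jq (ptsOf y 0) (ptsOf f 1) =
      (∑ k, ∑ l, tau l k * tau (f l) (y k)) / 4 + (∑ k : ZMod n, ∑ l : ZMod n, ((1 : ℚ) / 2)) / 2 := by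
    intro y
    rw [J_xf]
    have e : ∀ k l : ZMod n, (1 + tau l k * tau (f l) (y k)) / 2 =
      (1 / 2) * (tau l k * tau (f l) (y k)) + 1 / 2 := fun k l => by ring
    simp only [e]
    simp only [Finset.sum_add_distrib (f := fun l => (1 / 2) * (tau l _ * tau (f l) (y _)))]
    rw [Finset.sum_add_distrib]
    simp only [← Finset.mul_sum]
    ring
  unfold MaslovOf
  rw [jx, jx, jf, jf]
  linarith

lemma maslovO_tgt (G : GridDiagram n) {x : GridState n} {r : Rc n} (h : IsR x r) :
    MaslovO G x - MaslovO G (tgt x r) =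
      1 + 2 * (mc x r : ℚ) - 2 * ∑ i, (r.dom i (G.Orow i) : ℚ) := maslov_tgt h _ G.hO

lemma alex_tgt (G : GridDiagram n) {x : GridState n} {r : Rc n} (h : IsR x r) :
    Alex G x - Alex G (tgt x r) =
      ∑ i, (r.dom i (G.Xrow i) : ℚ) - ∑ i, (r.dom i (G.Orow i) : ℚ) := by
  have h1 := maslov_tgt h _ G.hO
  have h2 := maslov_tgt h _ G.hX
  unfold Alex MaslovO MaslovX
  linarith

lemma basisMap_homog (G : GridDiagram n) (f : GridState n → GC n) (a b : ℚ)
    (hf : ∀ x y k, MvPolynomial.coeff k (f x y) ≠ 0 →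
      (MaslovO G y - 2 * ∑ i : ZMod n, (k (some i) : ℚ) + 2 * (k none : ℚ) = MaslovO G x + a) ∧
      (Alex G y - ∑ i : ZMod n, (k (some i) : ℚ) = Alex G x + b)) :
    MapHomog G G (basisMap f) a b := by
  intro z d s hz y k hk
  have e : basisMap f z y = ∑ x ∈ z.support, z x * f x y := by
    simp [basisMap, Finsupp.lsum_apply, Finsupp.sum, Finsupp.finsetSum_apply]
  rw [e, MvPolynomial.coeff_sum] at hk
  obtain ⟨x, _, hx⟩ := Finset.exists_ne_zero_of_sum_ne_zero hk
  rw [MvPolynomial.coeff_mul] at hx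
  obtain ⟨p, hp, hpx⟩ := Finset.exists_ne_zero_of_sum_ne_zero hx
  have hp' := Finset.HasAntidiagonal.mem_antidiagonal.1 hp
  have h1 := hz x p.1 (left_ne_zero_of_mul hpx)
  have h2 := hf x y p.2 (right_ne_zero_of_mul hpx)
  have es : ∑ i : ZMod n, (k (some i) : ℚ) =
      ∑ i : ZMod n, (p.1 (some i) : ℚ) + ∑ i : ZMod n, (p.2 (some i) : ℚ) := by
    rw [← Finset.sum_add_distrib, ← hp']
    simp
  have en : (k none : ℚ) = p.1 none + p.2 none := by
    rw [← hp']; simp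
  rw [es, en]
  obtain ⟨h1a, h1b⟩ := h1
  obtain ⟨h2a, h2b⟩ := h2
  constructor <;> linarith

lemma MapHomog.add {G : GridDiagram n} {φ ψ : GC n →ₗ[Rng n] GC n} {a b : ℚ}
    (h1 : MapHomog G G φ a b) (h2 : MapHomog G G ψ a b) : MapHomog G G (φ + ψ) a b := by
  intro z d s hz y k hk
  by_cases h : MvPolynomial.coeff k (φ z y) = 0
  · apply h2 z d s hz y k
    intro h'
    apply hk
    simp [h, h']
  · exact h1 z d s hz y k h

lemma MapHomog.zero (G : GridDiagram n) (a b : ℚ) : MapHomog G G 0 a b := by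
  intro z d s hz y k hk
  simp at hk

lemma vsmul_homog (G : GridDiagram n) (i : ZMod n) :
    MapHomog G G ((Vv i) • (LinearMap.id : GC n →ₗ[Rng n] GC n)) (-2) (-1) := by
  have e : (Vv i) • (LinearMap.id : GC n →ₗ[Rng n] GC n) =
      basisMap fun x => Finsupp.single x (Vv i) := by
    apply map_ext
    intro x
    rw [basisMap_single]
    simp
  rw [e]
  apply basisMap_homog
  intro x y k hk
  by_cases hxy : x = y
  · subst hxy
    rw [Finsupp.single_eq_same, Vv, MvPolynomial.coeff_X] at hk
    have hk' : Finsupp.single (some i) 1 = k := by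
      by_contra h
      exact hk (if_neg h)
    subst hk'
    have : ∑ j : ZMod n, ((Finsupp.single (some i) 1 : Option (ZMod n) →₀ ℕ) (some j) : ℚ) = 1 := by
      simp [Finsupp.single_apply]
    rw [this]
    simp
    constructor <;> ring
  · rw [Finsupp.single_eq_of_ne (fun e => hxy e.symm)] at hk
    simp at hk

/-- exponent of the weight of a rectangle -/
def wexp (G : GridDiagram n) (x : GridState n) (r : Rc n) : Option (ZMod n) →₀ ℕ :=
  Finsupp.equivFunOnFinite.symm fun o => o.elim (mc x r) fun i => r.dom i (G.Orow i)

lemma wtc_eq (G : GridDiagram n) (x : GridState n) (r : Rc n) :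
    wtc G x r = MvPolynomial.monomial (wexp G x r) 1 := by
  rw [MvPolynomial.monomial_eq, Finsupp.prod_fintype _ _ (by simp)]
  simp [wtc, wexp, Vv, vV, Fintype.prod_option, mul_comm]

lemma cmap_homog (G : GridDiagram n) (j : ZMod n) : MapHomog G G (cmap G (ind j)) (-1) (-1) := by
  apply basisMap_homog
  intro x y k hk
  rw [Finsupp.finsetSum_apply, MvPolynomial.coeff_sum] at hk
  obtain ⟨r, hr, hk⟩ := Finset.exists_ne_zero_of_sum_ne_zero hk
  have hr' := (Finset.mem_filter.1 hr).2
  by_cases hxy : tgt x r = y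
  · subst hxy
    rw [Finsupp.single_eq_same, wtc_eq, MvPolynomial.coeff_monomial] at hk
    have hk' : wexp G x r = k := by
      by_contra h
      exact hk (if_neg h)
    subst hk'
    have h1 := maslovO_tgt G hr'.1
    have h2 := alex_tgt G hr'.1
    have h3 : ∑ i, (r.dom i (G.Xrow i) : ℚ) = 1 := by
      simp [hr'.2, ind]
    have h4 : ∀ i, wexp G x r (some i) = r.dom i (G.Orow i) := fun i => rfl
    have h5 : wexp G x r none = mc x r := rfl
    simp only [h4, h5]
    constructor <;> linarith
  · rw [Finsupp.single_eq_of_ne (fun e => hxy e.symm)] at hk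
    simp at hk

lemma char_two (a : Rng n) : a + a = 0 := CharTwo.add_self_eq_zero a

lemma homotopy_chain (G : GridDiagram n) (i : ZMod n) (k : ℕ) :
    ∃ H : GC n →ₗ[Rng n] GC n, MapHomog G G H (-1) (-1) ∧
      diff4 G ∘ₗ H + H ∘ₗ diff4 G =
        (Vv i + Vv ((((Equiv.ofBijective G.Orow G.hO).trans
          (Equiv.ofBijective G.Xrow G.hX).symm) ^ k) i)) •
            (LinearMap.id : GC n →ₗ[Rng n] GC n) := by
  induction k with
  | zero =>
    refine ⟨0, MapHomog.zero G _ _, ?_⟩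
    simp [char_two]
  | succ k ih =>
    obtain ⟨H, hH, hd⟩ := ih
    rw [pow_succ', Equiv.Perm.mul_apply]
    set l := (((Equiv.ofBijective G.Orow G.hO).trans
      (Equiv.ofBijective G.Xrow G.hX).symm) ^ k) i with hl
    set j := ((Equiv.ofBijective G.Orow G.hO).trans (Equiv.ofBijective G.Xrow G.hX).symm) l with hj
    have hlj : G.Orow l = G.Xrow j :=
      ((Equiv.ofBijective G.Xrow G.hX).apply_symm_apply (G.Orow l)).symm
    refine ⟨H + cmap G (ind j), hH.add (cmap_homog G j), ?_⟩
    have hc := cmap_commut G l j hlj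
    rw [← diff4_eq] at hc
    have e : Vv i + Vv j = (Vv i + Vv l) + (Vv l + Vv j) := by
      have := char_two (Vv l)
      linear_combination (-1 : Rng n) * this
    rw [e, add_smul, ← hd, ← hc, LinearMap.comp_add, LinearMap.add_comp]
    abel

lemma statement8_aux (G : GridDiagram n) (hK : IsKnot G) (i j : ZMod n) :
    MapHomog G G ((Vv i) • (LinearMap.id : GC n →ₗ[Rng n] GC n)) (-2) (-1) ∧
    MapHomog G G ((Vv j) • (LinearMap.id : GC n →ₗ[Rng n] GC n)) (-2) (-1) ∧
    ∃ H : GC n →ₗ[Rng n] GC n,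
      MapHomog G G H (-1) (-1) ∧
      diff4 G ∘ₗ H + H ∘ₗ diff4 G
        = (Vv i + Vv j) • (LinearMap.id : GC n →ₗ[Rng n] GC n) := by
  refine ⟨vsmul_homog G i, vsmul_homog G j, ?_⟩
  obtain ⟨k, rfl⟩ := hK i j
  exact homotopy_chain G i k

end

/-- If `𝔾` represents a knot then, for any pair of indices `i, j`,
multiplication by `V_i` is chain homotopic to multiplication by `V_j`, viewed as
homogeneous endomorphisms of `(GC•(𝔾₄), ∂₄•)` of degree `(−2, −1)` (over
`𝔽 = ℤ/2ℤ`, so `V_i + V_j = V_i − V_j`). -/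
theorem statement8 (n : ℕ) [NeZero n] (G : GridDiagram n) (hK : IsKnot G)
    (i j : ZMod n) :
    MapHomog G G ((Vv i) • (LinearMap.id : GC n →ₗ[Rng n] GC n)) (-2) (-1) ∧
    MapHomog G G ((Vv j) • (LinearMap.id : GC n →ₗ[Rng n] GC n)) (-2) (-1) ∧
    ∃ H : GC n →ₗ[Rng n] GC n,
      MapHomog G G H (-1) (-1) ∧
      diff4 G ∘ₗ H + H ∘ₗ diff4 G
        = (Vv i + Vv j) • (LinearMap.id : GC n →ₗ[Rng n] GC n) := by
  exact statement8_aux G hK i j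

end GridHomology
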